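/- arXiv:1802.06429 — 5 statements merged into one kernel-verified Lean document; each statement's English description precedes it below -/
import Mathlib

section
/- Assume M[n] = 0, i.e., M has no nonzero element killed by n. Then the map sending the class of a 1-cocycle c : Δ → M to the class of the unique b ∈ M satisfying n·c(δ) = δ·b − b for all δ ∈ Δ (such b exists and lies in Ψ(M)) is a group isomorphism H^1(Δ, M) ≅ Ψ(M)/(M^Δ + nM). -/
/-! Additive group cohomology in low degree, hand-rolled, for a group `Δ` acting on an
abelian group `M` by group automorphisms (`DistribMulAction Δ M`). -/

namespace CapAdd

variable (Δ M : Type*) [Group Δ] [AddCommGroup M] [DistribMulAction Δ M]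

/-- The invariants `M^Δ`. -/
def invts : AddSubgroup M where
  carrier := {m | ∀ δ : Δ, δ • m = m}
  zero_mem' := fun δ => smul_zero δ
  add_mem' := by
    intro a b ha hb δ
    rw [smul_add, ha δ, hb δ]
  neg_mem' := by
    intro a ha δ
    rw [smul_neg, ha δ]

variable {Δ} in
/-- Multiplication by `n` as an additive homomorphism. -/
def nsmulHom (n : ℕ) : M →+ M where
  toFun m := n • m
  map_zero' := smul_zero n
  map_add' a b := nsmul_add a b n

/-- The `n`-torsion subgroup `M[n]`. -/
def ntors (n : ℕ) : AddSubgroup M := (nsmulHom M n).ker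

/-- The subgroup `nM` of multiples of `n`. -/
def nsmulSub (n : ℕ) : AddSubgroup M := (nsmulHom M n).range

/-- The subgroup `Ψ(M) = {m : ∀ δ, δ•m - m ∈ nM}`. -/
def psi (n : ℕ) : AddSubgroup M where
  carrier := {m | ∀ δ : Δ, δ • m - m ∈ nsmulSub M n}
  zero_mem' := by
    intro δ
    simp only [smul_zero, sub_zero]
    exact zero_mem _
  add_mem' := by
    intro a b ha hb δ
    have : δ • (a + b) - (a + b) = (δ • a - a) + (δ • b - b) := by
      rw [smul_add]; abel
    rw [this]
    exact add_mem (ha δ) (hb δ)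
  neg_mem' := by
    intro a ha δ
    have : δ • (-a) - (-a) = -(δ • a - a) := by rw [smul_neg]; abel
    rw [this]
    exact neg_mem (ha δ)

/-- 1-cocycles with values in the subgroup `N` of `M`. -/
def Z1 (N : AddSubgroup M) : AddSubgroup (Δ → M) where
  carrier := {c | (∀ δ, c δ ∈ N) ∧ ∀ δ ε : Δ, c (δ * ε) = δ • c ε + c δ}
  zero_mem' := ⟨fun _ => N.zero_mem, by intro δ ε; simp⟩
  add_mem' := by
    rintro a b ⟨haN, ha⟩ ⟨hbN, hb⟩
    refine ⟨fun δ => N.add_mem (haN δ) (hbN δ), fun δ ε => ?_⟩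
    simp only [Pi.add_apply, ha δ ε, hb δ ε, smul_add]
    abel
  neg_mem' := by
    rintro a ⟨haN, ha⟩
    refine ⟨fun δ => N.neg_mem (haN δ), fun δ ε => ?_⟩
    simp only [Pi.neg_apply, ha δ ε, smul_add, smul_neg, neg_add]

/-- 1-coboundaries coming from elements of the subgroup `N` of `M`. -/
def B1 (N : AddSubgroup M) : AddSubgroup (Δ → M) where
  carrier := {c | ∃ m ∈ N, ∀ δ : Δ, c δ = δ • m - m}
  zero_mem' := ⟨0, N.zero_mem, by simp⟩
  add_mem' := by
    rintro a b ⟨ma, hma, ha⟩ ⟨mb, hmb, hb⟩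
    refine ⟨ma + mb, N.add_mem hma hmb, fun δ => ?_⟩
    simp only [Pi.add_apply, ha δ, hb δ, smul_add]
    abel
  neg_mem' := by
    rintro a ⟨ma, hma, ha⟩
    refine ⟨-ma, N.neg_mem hma, fun δ => ?_⟩
    simp only [Pi.neg_apply, ha δ, smul_neg]
    abel

/-- First group cohomology `H¹(Δ, N)` for a (`Δ`-stable) subgroup `N` of `M`. -/
abbrev H1 (N : AddSubgroup M) :=
  Z1 Δ M N ⧸ ((B1 Δ M N).addSubgroupOf (Z1 Δ M N))

/-- The inclusion of cocycles valued in `N` into cocycles valued in `N'` for `N ≤ N'`. -/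
def Z1incl {N N' : AddSubgroup M} (h : N ≤ N') : ↥(Z1 Δ M N) →+ ↥(Z1 Δ M N') where
  toFun c := ⟨(c : Δ → M), ⟨fun δ => h (c.2.1 δ), c.2.2⟩⟩
  map_zero' := rfl
  map_add' _ _ := rfl

/-- The morphism `H¹(Δ, N) →+ H¹(Δ, N')` induced by an inclusion `N ≤ N'`. -/
def H1incl {N N' : AddSubgroup M} (h : N ≤ N') : H1 Δ M N →+ H1 Δ M N' :=
  QuotientAddGroup.map _ _ (Z1incl Δ M h) (by
    rintro ⟨c, hc⟩ hmem
    rcases hmem with ⟨m, hmN, hm⟩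
    exact ⟨m, h hmN, hm⟩)

end CapAdd

open CapAdd

/-- The hom `c ↦ -∑ c` from cocycles to `Ψ(M)`. -/
lemma neg_sum_spec (Δ M : Type*) [Group Δ] [Fintype Δ] [AddCommGroup M] [DistribMulAction Δ M]
    (n : ℕ) (hn : Fintype.card Δ = n) (c : ↥(Z1 Δ M ⊤)) (δ : Δ) :
    n • (c : Δ → M) δ = δ • (-∑ ε, (c : Δ → M) ε) - (-∑ ε, (c : Δ → M) ε) := by
  have h1 : ∑ ε, (c : Δ → M) (δ * ε) = ∑ ε, (c : Δ → M) ε :=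
    Equiv.sum_comp (Equiv.mulLeft δ) (c : Δ → M)
  have h2 : ∑ ε, (c : Δ → M) (δ * ε) = δ • (∑ ε, (c : Δ → M) ε) + n • (c : Δ → M) δ := by
    rw [Finset.sum_congr rfl (fun ε _ => c.2.2 δ ε), Finset.sum_add_distrib, Finset.smul_sum]
    simp [hn]
  rw [h1] at h2
  rw [smul_neg, sub_neg_eq_add]
  nth_rewrite 2 [h2]
  abel

/-- The map `c ↦ -∑ c` from cocycles to `Ψ(M)`. -/
def toPsi (Δ M : Type*) [Group Δ] [Fintype Δ] [AddCommGroup M] [DistribMulAction Δ M]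
    (n : ℕ) (hn : Fintype.card Δ = n) : ↥(Z1 Δ M ⊤) →+ ↥(psi Δ M n) where
  toFun c := ⟨-∑ ε, (c : Δ → M) ε, fun δ => ⟨(c : Δ → M) δ, neg_sum_spec Δ M n hn c δ⟩⟩
  map_zero' := by ext; simp
  map_add' a b := by ext; simp [Finset.sum_add_distrib, add_comm]

lemma toPsi_spec (Δ M : Type*) [Group Δ] [Fintype Δ] [AddCommGroup M] [DistribMulAction Δ M]
    (n : ℕ) (hn : Fintype.card Δ = n) (c : ↥(Z1 Δ M ⊤)) (δ : Δ) :
    n • (c : Δ → M) δ = δ • (toPsi Δ M n hn c : M) - (toPsi Δ M n hn c : M) :=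
  neg_sum_spec Δ M n hn c δ

/-- Two elements of `Ψ(M)` attached to the same cocycle have the same class. -/
lemma mk_eq_of_spec (Δ M : Type*) [Group Δ] [AddCommGroup M] [DistribMulAction Δ M]
    (n : ℕ) (a b : ↥(psi Δ M n))
    (h : ∀ δ : Δ, δ • (a : M) - (a : M) = δ • (b : M) - (b : M)) :
    (QuotientAddGroup.mk a :
      ↥(psi Δ M n) ⧸ ((invts Δ M ⊔ nsmulSub M n).addSubgroupOf (psi Δ M n))) =
      QuotientAddGroup.mk b := by
  rw [QuotientAddGroup.eq, AddSubgroup.mem_addSubgroupOf]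
  refine AddSubgroup.mem_sup_left (fun δ => ?_)
  have := h δ
  push_cast
  rw [smul_add, smul_neg, ← sub_eq_zero]
  rw [← sub_eq_zero] at this
  rw [← neg_eq_zero, ← this]
  abel

/-- If `M[n] = 0` then `H¹(Δ, M) ≅ Ψ(M)/(M^Δ + nM)`, via the map sending
the class of a 1-cocycle `c` to the class of the unique `b` with `n•c(δ) = δ•b - b` for all
`δ` (such a `b` exists and lies in `Ψ(M)`). -/
theorem stmt3 (Δ M : Type*) [Group Δ] [Fintype Δ] [AddCommGroup M] [DistribMulAction Δ M]
    (n : ℕ) (hn : Fintype.card Δ = n)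
    (htf : ∀ m : M, n • m = 0 → m = 0) :
    ∃ e : H1 Δ M ⊤ ≃+
        (↥(psi Δ M n) ⧸ ((invts Δ M ⊔ nsmulSub M n).addSubgroupOf (psi Δ M n))),
      (∀ c : ↥(Z1 Δ M ⊤), ∃ b : ↥(psi Δ M n),
        ∀ δ : Δ, n • (c : Δ → M) δ = δ • (b : M) - (b : M)) ∧
      (∀ (c : ↥(Z1 Δ M ⊤)) (b : ↥(psi Δ M n)),
        (∀ δ : Δ, n • (c : Δ → M) δ = δ • (b : M) - (b : M)) →
          e (QuotientAddGroup.mk c) = QuotientAddGroup.mk b) := by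
  let Q := (invts Δ M ⊔ nsmulSub M n).addSubgroupOf (psi Δ M n)
  let f : ↥(Z1 Δ M ⊤) →+ (↥(psi Δ M n) ⧸ Q) :=
    (QuotientAddGroup.mk' Q).comp (toPsi Δ M n hn)
  have hspec := toPsi_spec Δ M n hn
  have hker : ∀ c, f c = 0 ↔ c ∈ (B1 Δ M ⊤).addSubgroupOf (Z1 Δ M ⊤) := by
    intro c
    have h0 : f c = 0 ↔ (toPsi Δ M n hn c : M) ∈ invts Δ M ⊔ nsmulSub M n :=
      (QuotientAddGroup.eq_zero_iff _).trans AddSubgroup.mem_addSubgroupOf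
    rw [h0, AddSubgroup.mem_addSubgroupOf, AddSubgroup.mem_sup]
    constructor
    · rintro ⟨i, hi, _, ⟨m, rfl⟩, h⟩
      refine ⟨m, trivial, fun δ => ?_⟩
      rw [← sub_eq_zero]
      apply htf
      have h1 := hspec c δ
      have h2 : δ • i = i := hi δ
      have h3 : i + n • m = (toPsi Δ M n hn c : M) := h
      rw [nsmul_sub, h1, ← h3, smul_add, h2, smul_comm δ n m, nsmul_sub]
      abel
    · rintro ⟨m, -, h⟩
      refine ⟨(toPsi Δ M n hn c : M) - n • m, fun δ => ?_, n • m, ⟨m, rfl⟩, sub_add_cancel _ _⟩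
      have h1 := hspec c δ
      rw [h δ, nsmul_sub] at h1
      rw [smul_sub, smul_comm δ n m, sub_eq_sub_iff_sub_eq_sub, ← h1]
  let g : H1 Δ M ⊤ →+ (↥(psi Δ M n) ⧸ Q) :=
    QuotientAddGroup.lift _ f (fun c hc => (hker c).2 hc)
  have hgf : ∀ c : ↥(Z1 Δ M ⊤), g (QuotientAddGroup.mk c) = f c := fun c => rfl
  have key : ∀ (c : ↥(Z1 Δ M ⊤)) (b : ↥(psi Δ M n)),
        (∀ δ : Δ, n • (c : Δ → M) δ = δ • (b : M) - (b : M)) →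
          g (QuotientAddGroup.mk c) = QuotientAddGroup.mk b := by
    intro c b h
    exact mk_eq_of_spec Δ M n _ b (fun δ => (hspec c δ).symm.trans (h δ))
  have hinj : Function.Injective g := by
    rw [injective_iff_map_eq_zero]
    intro x
    induction x using QuotientAddGroup.induction_on with
    | H c =>
      intro h
      exact (QuotientAddGroup.eq_zero_iff c).2 ((hker c).1 h)
  have hsurj : Function.Surjective g := by
    intro x
    induction x using QuotientAddGroup.induction_on with
    | H b =>
      have hb : ∀ δ : Δ, ∃ m : M, n • m = δ • (b : M) - (b : M) := fun δ => b.2 δ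
      choose c hc using hb
      refine ⟨QuotientAddGroup.mk ⟨c, fun _ => trivial, fun δ ε => ?_⟩, key _ b hc⟩
      rw [← sub_eq_zero]
      apply htf
      rw [nsmul_sub, nsmul_add, hc, ← smul_comm δ n (c ε), hc, hc, smul_sub, mul_smul]
      abel
  exact ⟨AddEquiv.ofBijective g ⟨hinj, hsurj⟩, fun c => ⟨toPsi Δ M n hn c, hspec c⟩, key⟩
end

section
/- Let R → B be an injective homomorphism of commutative rings making B a faithfully flat R-module, and let n ≥ 1. For a unit a ∈ Rˣ whose image in B is the n-th power of a unit u ∈ Bˣ, the element ζ = (u⊗1)·(1⊗u)⁻¹ of (B ⊗_R B)ˣ satisfies ζⁿ = 1 and d₂(ζ) = 1, and the assignment a ↦ [ζ] induces a well-defined injective group homomorphism from (Rˣ ∩ (Bˣ)ⁿ)/(Rˣ)ⁿ to the quotient group {ζ ∈ (B ⊗_R B)ˣ : ζⁿ = 1 and d₂(ζ) = 1} / {(ξ⊗1)·(1⊗ξ)⁻¹ : ξ ∈ Bˣ, ξⁿ = 1}. Here Rˣ ∩ (Bˣ)ⁿ denotes the subgroup of units of R whose image in B is an n-th power of a unit of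 B. -/
/-! Čech complex in low degrees of the multiplicative group for a ring extension `R → B`,
using the (right-nested) tensor powers `B`, `B ⊗[R] B`, `B ⊗[R] (B ⊗[R] B)`, ... -/

namespace CapCech

noncomputable section

open Algebra.TensorProduct

variable (R B : Type*) [CommRing R] [CommRing B] [Algebra R B]

/-- `B ⊗[R] B`. -/
abbrev T2 := TensorProduct R B B

/-- `B ⊗[R] B ⊗[R] B` (right-nested). -/
abbrev T3 := TensorProduct R B (T2 R B)

/-- `B ⊗[R] B ⊗[R] B ⊗[R] B` (right-nested). -/
abbrev T4 := TensorProduct R B (T3 R B)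

/-- `q₁₂ : x ⊗ y ↦ x ⊗ y ⊗ 1`, i.e. insertion of `1` in position 3. -/
def q12 : T2 R B →ₐ[R] T3 R B :=
  Algebra.TensorProduct.map (AlgHom.id R B) includeLeft

/-- `q₁₃ : x ⊗ y ↦ x ⊗ 1 ⊗ y`, i.e. insertion of `1` in position 2. -/
def q13 : T2 R B →ₐ[R] T3 R B :=
  Algebra.TensorProduct.map (AlgHom.id R B) includeRight

/-- `q₂₃ : x ⊗ y ↦ 1 ⊗ x ⊗ y`, i.e. insertion of `1` in position 1. -/
def q23 : T2 R B →ₐ[R] T3 R B := includeRight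

/-- Insertion of `1` in position 1, `T3 → T4`. -/
def r1 : T3 R B →ₐ[R] T4 R B := includeRight

/-- Insertion of `1` in position 2, `T3 → T4`. -/
def r2 : T3 R B →ₐ[R] T4 R B :=
  Algebra.TensorProduct.map (AlgHom.id R B) includeRight

/-- Insertion of `1` in position 3, `T3 → T4`. -/
def r3 : T3 R B →ₐ[R] T4 R B :=
  Algebra.TensorProduct.map (AlgHom.id R B)
    (Algebra.TensorProduct.map (AlgHom.id R B) includeRight)

/-- Insertion of `1` in position 4, `T3 → T4`. -/
def r4 : T3 R B →ₐ[R] T4 R B :=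
  Algebra.TensorProduct.map (AlgHom.id R B)
    (Algebra.TensorProduct.map (AlgHom.id R B) includeLeft)

/-- The Čech differential `d₁ : Bˣ → (B ⊗ B)ˣ`, `u ↦ (u ⊗ 1)·(1 ⊗ u)⁻¹`. -/
def d1 : Bˣ →* (T2 R B)ˣ :=
  Units.map (includeLeft : B →ₐ[R] T2 R B).toRingHom.toMonoidHom /
    Units.map (includeRight : B →ₐ[R] T2 R B).toRingHom.toMonoidHom

/-- The Čech differential `d₂ : (B ⊗ B)ˣ → (B ⊗ B ⊗ B)ˣ`,
`ξ ↦ q₂₃(ξ)·q₁₃(ξ)⁻¹·q₁₂(ξ)`. -/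
def d2 : (T2 R B)ˣ →* (T3 R B)ˣ where
  toFun ξ := Units.map (q23 R B).toRingHom.toMonoidHom ξ *
      (Units.map (q13 R B).toRingHom.toMonoidHom ξ)⁻¹ *
    Units.map (q12 R B).toRingHom.toMonoidHom ξ
  map_one' := by simp
  map_mul' x y := by
    ext
    simp only [map_mul, mul_inv_rev, Units.val_mul]
    ring

/-- The Čech differential `d₃ : (B ⊗ B ⊗ B)ˣ → (B ⊗ B ⊗ B ⊗ B)ˣ`, the alternating product
of the four insertion maps. -/
def d3 : (T3 R B)ˣ →* (T4 R B)ˣ where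
  toFun ξ := Units.map (r1 R B).toRingHom.toMonoidHom ξ *
      (Units.map (r2 R B).toRingHom.toMonoidHom ξ)⁻¹ *
    (Units.map (r3 R B).toRingHom.toMonoidHom ξ *
      (Units.map (r4 R B).toRingHom.toMonoidHom ξ)⁻¹)
  map_one' := by simp
  map_mul' x y := by
    ext
    simp only [map_mul, mul_inv_rev, Units.val_mul]
    ring

end

end CapCech

open CapCech

theorem CapCech.comm_aux {G : Type*} [CommGroup G] (x y z : G) (h : x * z = y) :
    x * y⁻¹ * z = 1 := by
  rw [mul_right_comm, h, mul_inv_cancel]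

theorem CapCech.group_aux {A U V W : Type*} [CommGroup A] [CommGroup U] [CommGroup V]
    [CommGroup W] (i : A →* U) (d : U →* V) (e : V →* W) (n : ℕ)
    (hi : Function.Injective i) (hdi : ∀ a, d (i a) = 1) (hed : ∀ u, e (d u) = 1)
    (hex : ∀ u, d u = 1 → ∃ a, i a = u) :
    (∀ (a : A) (u : U), i a = u ^ n → (d u) ^ n = 1 ∧ e (d u) = 1) ∧
    ∃ φ : (↥(((powMonoidHom n : U →* U).range).comap i) ⧸
          ((powMonoidHom n : A →* A).range.subgroupOf
            (((powMonoidHom n : U →* U).range).comap i))) →*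
        (↥((powMonoidHom n : V →* V).ker ⊓ e.ker) ⧸
          ((Subgroup.map d (powMonoidHom n : U →* U).ker).subgroupOf
            ((powMonoidHom n : V →* V).ker ⊓ e.ker))),
      Function.Injective φ ∧
      ∀ (a : ↥(((powMonoidHom n : U →* U).range).comap i))
        (u : U), i (a : A) = u ^ n →
        ∀ z : ↥((powMonoidHom n : V →* V).ker ⊓ e.ker),
          (z : V) = d u →
            φ (QuotientGroup.mk a) = QuotientGroup.mk z := by
  have h1 : ∀ (a : A) (u : U), i a = u ^ n → (d u) ^ n = 1 ∧ e (d u) = 1 := by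
    intro a u h
    exact ⟨by rw [← map_pow, ← h, hdi], hed u⟩
  refine ⟨h1, ?_⟩
  have hS : ∀ a : ↥(((powMonoidHom n : U →* U).range).comap i), ∃ u : U, i (a : A) = u ^ n := by
    rintro ⟨a, u, hu⟩
    exact ⟨u, hu.symm⟩
  choose r hr using hS
  have key : ∀ (u v : U) (z w : ↥((powMonoidHom n : V →* V).ker ⊓ e.ker)),
      u ^ n = v ^ n → (z : V) = d u → (w : V) = d v →
      (QuotientGroup.mk z : ↥((powMonoidHom n : V →* V).ker ⊓ e.ker) ⧸
          ((Subgroup.map d (powMonoidHom n : U →* U).ker).subgroupOf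
            ((powMonoidHom n : V →* V).ker ⊓ e.ker))) = QuotientGroup.mk w := by
    intro u v z w huv hz hw
    rw [QuotientGroup.eq_iff_div_mem, Subgroup.mem_subgroupOf]
    refine ⟨u / v, ?_, ?_⟩
    · simp [MonoidHom.mem_ker, div_pow, huv]
    · rw [map_div, Subgroup.coe_div, hz, hw]
  have hmem : ∀ a, d (r a) ∈ (powMonoidHom n : V →* V).ker ⊓ e.ker := fun a =>
    ⟨(h1 _ _ (hr a)).1, (h1 _ _ (hr a)).2⟩
  let ψ : ↥(((powMonoidHom n : U →* U).range).comap i) →*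
      (↥((powMonoidHom n : V →* V).ker ⊓ e.ker) ⧸
          ((Subgroup.map d (powMonoidHom n : U →* U).ker).subgroupOf
            ((powMonoidHom n : V →* V).ker ⊓ e.ker))) :=
    MonoidHom.mk' (fun a => QuotientGroup.mk ⟨d (r a), hmem a⟩) (by
      intro a b
      rw [← QuotientGroup.mk_mul]
      refine key (r (a * b)) (r a * r b) _ _ ?_ rfl ?_
      · rw [mul_pow, ← hr, ← hr, ← hr, Subgroup.coe_mul, map_mul]
      · simp)
  have hψ : ∀ a, ψ a = QuotientGroup.mk ⟨d (r a), hmem a⟩ := fun _ => rfl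
  have hker : (powMonoidHom n : A →* A).range.subgroupOf
            (((powMonoidHom n : U →* U).range).comap i) = ψ.ker := by
    ext a
    rw [Subgroup.mem_subgroupOf, MonoidHom.mem_ker, hψ]
    constructor
    · rintro ⟨b, hb⟩
      rw [← QuotientGroup.mk_one]
      refine key (r a) (i b) _ _ ?_ rfl ?_
      · rw [← hr, ← hb]; simp
      · simp [hdi]
    · intro h
      rw [QuotientGroup.eq_one_iff, Subgroup.mem_subgroupOf] at h
      obtain ⟨ξ, hξ, hd⟩ := h
      have hξ' : ξ ^ n = 1 := hξ
      have hd' : d ξ = d (r a) := hd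
      obtain ⟨b, hb⟩ := hex (r a / ξ) (by rw [map_div, hd', div_self'])
      refine ⟨b, hi ?_⟩
      rw [hr, powMonoidHom_apply, map_pow, hb, div_pow, hξ', div_one]
  refine ⟨QuotientGroup.lift _ ψ hker.le, ?_, ?_⟩
  · rw [QuotientGroup.injective_lift_iff]
    exact hker
  · intro a u hu z hz
    rw [QuotientGroup.lift_mk', hψ]
    exact key (r a) u _ _ (by rw [← hr, hu]) rfl hz

open scoped TensorProduct in
theorem CapCech.d1_val (R B : Type*) [CommRing R] [CommRing B] [Algebra R B] (u : Bˣ) :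
    (d1 R B u : T2 R B) = (u : B) ⊗ₜ[R] ((u⁻¹ : Bˣ) : B) := by
  simp [d1, div_eq_mul_inv, ← map_inv]

/-- Let `R → B` be an injective ring map making `B` a faithfully flat
`R`-module, and `n ≥ 1`.  If a unit `a ∈ Rˣ` becomes an `n`-th power `uⁿ` of a unit in `B`,
then `ζ = (u ⊗ 1)(1 ⊗ u)⁻¹` satisfies `ζⁿ = 1` and `d₂ ζ = 1`, and `a ↦ [ζ]` induces a
well-defined injective homomorphism
`(Rˣ ∩ (Bˣ)ⁿ)/(Rˣ)ⁿ → {ζ : ζⁿ = 1, d₂ ζ = 1}/{(ξ ⊗ 1)(1 ⊗ ξ)⁻¹ : ξⁿ = 1}`. -/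
theorem stmt7 (R B : Type*) [CommRing R] [CommRing B] [Algebra R B]
    (hinj : Function.Injective (algebraMap R B)) [Module.FaithfullyFlat R B]
    (n : ℕ) (hn : 1 ≤ n) :
    (∀ (a : Rˣ) (u : Bˣ), Units.map (algebraMap R B).toMonoidHom a = u ^ n →
      (d1 R B u) ^ n = 1 ∧ d2 R B (d1 R B u) = 1) ∧
    ∃ φ : (↥(((powMonoidHom n : Bˣ →* Bˣ).range).comap
            (Units.map (algebraMap R B).toMonoidHom)) ⧸
          ((powMonoidHom n : Rˣ →* Rˣ).range.subgroupOf
            (((powMonoidHom n : Bˣ →* Bˣ).range).comap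
              (Units.map (algebraMap R B).toMonoidHom)))) →*
        (↥((powMonoidHom n : (T2 R B)ˣ →* (T2 R B)ˣ).ker ⊓ (d2 R B).ker) ⧸
          ((Subgroup.map (d1 R B) (powMonoidHom n : Bˣ →* Bˣ).ker).subgroupOf
            ((powMonoidHom n : (T2 R B)ˣ →* (T2 R B)ˣ).ker ⊓ (d2 R B).ker))),
      Function.Injective φ ∧
      ∀ (a : ↥(((powMonoidHom n : Bˣ →* Bˣ).range).comap
            (Units.map (algebraMap R B).toMonoidHom)))
        (u : Bˣ), Units.map (algebraMap R B).toMonoidHom (a : Rˣ) = u ^ n →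
        ∀ z : ↥((powMonoidHom n : (T2 R B)ˣ →* (T2 R B)ˣ).ker ⊓ (d2 R B).ker),
          (z : (T2 R B)ˣ) = d1 R B u →
            φ (QuotientGroup.mk a) = QuotientGroup.mk z := by
  refine CapCech.group_aux (A := Rˣ) (U := Bˣ) (V := (T2 R B)ˣ) (W := (T3 R B)ˣ)
    (Units.map (algebraMap R B).toMonoidHom) (d1 R B) (d2 R B) n
    (Units.map_injective hinj) ?_ ?_ ?_
  · intro a
    rw [d1, MonoidHom.div_apply, div_eq_one]
    ext
    simp
  · intro u
    have e1 : Units.map (q23 R B).toRingHom.toMonoidHom (d1 R B u) *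
        Units.map (q12 R B).toRingHom.toMonoidHom (d1 R B u) =
        Units.map (q13 R B).toRingHom.toMonoidHom (d1 R B u) := by
      ext
      simp [CapCech.d1_val, q12, q13, q23]
    exact CapCech.comm_aux (G := (T3 R B)ˣ) _ _ _ e1
  · intro u hu
    rw [d1, MonoidHom.div_apply, div_eq_one] at hu
    have hE := Algebra.IsEffective.of_faithfullyFlat R B
    have aux : ∀ v : Bˣ, Algebra.TensorProduct.includeLeft (R := R) (S := R) (A := B) (B := B) (v : B)
          = Algebra.TensorProduct.includeRight (R := R) (A := B) (B := B) (v : B) →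
        ∃ r : R, algebraMap R B r = v := by
      intro v hv
      exact (hE v).mp (sub_eq_zero.mpr hv)
    obtain ⟨r, hr⟩ := aux u (congrArg Units.val hu)
    obtain ⟨s, hs⟩ := aux u⁻¹ (by
      have := congrArg (fun x => ((x⁻¹ : (T2 R B)ˣ) : T2 R B)) hu
      simp only [← map_inv] at this
      exact this)
    have hrs : r * s = 1 := hinj (by rw [map_mul, hr, hs, map_one, Units.mul_inv])
    exact ⟨⟨r, s, hrs, by rw [mul_comm, hrs]⟩, Units.ext hr⟩
end

section
/- There is an exact sequence of abelian groups 1 → (U_F ∩ U_Kⁿ)/U_Fⁿ → H^1(Δ, μ_n(K)) → H^1(Δ, U_K) → Ψ(K/F,S)/(U_F·U_Kⁿ) → H^2(Δ, μ_n(K)), in which: the first map sends the class of an element a = uⁿ ∈ U_F ∩ U_Kⁿ (with u ∈ U_K) to the class of the 1-cocycle σ ↦ σ(u)·u⁻¹, which takes values in μ_n(K); the second map is induced by the inclusion μ_n(K) ⊆ U_K; the third map sends the class of a 1-cocycle c : Δ → U_K to the class of any b ∈ U_K satisfying c(σ)ⁿ = σ(b)·b⁻¹ for all σ ∈ Δ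 (such b exists and necessarily lies in Ψ(K/F,S)); and the fourth map sends the class of b ∈ Ψ(K/F,S) to the class of the 2-cocycle (σ, τ) ↦ σ(c(τ))·c(στ)⁻¹·c(σ), where c : Δ → U_K is any function with c(σ)ⁿ = σ(b)·b⁻¹ for all σ (this 2-cocycle automatically takes values in μ_n(K)). -/
/-! Multiplicative group cohomology in low degrees, hand-rolled, for a group `Δ` acting on a
commutative group `U` by group automorphisms (`MulDistribMulAction Δ U`). -/

namespace CapMul

variable (Δ U : Type*) [Group Δ] [CommGroup U] [MulDistribMulAction Δ U]

/-- The invariants `U^Δ`. -/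
def invts : Subgroup U where
  carrier := {u | ∀ δ : Δ, δ • u = u}
  one_mem' := fun δ => smul_one δ
  mul_mem' := by
    intro a b ha hb δ
    rw [smul_mul', ha δ, hb δ]
  inv_mem' := by
    intro a ha δ
    rw [smul_inv', ha δ]

/-- The subgroup `Uⁿ` of `n`-th powers. -/
def npowSub (n : ℕ) : Subgroup U := (powMonoidHom n : U →* U).range

/-- The `n`-torsion subgroup of `U`. -/
def ntors (n : ℕ) : Subgroup U := (powMonoidHom n : U →* U).ker

/-- The subgroup `Ψ = {u : ∀ δ, (δ•u)·u⁻¹ ∈ Uⁿ}`. -/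
def psi (n : ℕ) : Subgroup U where
  carrier := {u | ∀ δ : Δ, δ • u * u⁻¹ ∈ npowSub U n}
  one_mem' := by
    intro δ
    simp only [smul_one, one_mul, inv_one]
    exact one_mem _
  mul_mem' := by
    intro a b ha hb δ
    have : δ • (a * b) * (a * b)⁻¹ = (δ • a * a⁻¹) * (δ • b * b⁻¹) := by
      rw [smul_mul', mul_inv]
      exact mul_mul_mul_comm _ _ _ _
    rw [this]
    exact mul_mem (ha δ) (hb δ)
  inv_mem' := by
    intro a ha δ
    have : δ • a⁻¹ * (a⁻¹)⁻¹ = (δ • a * a⁻¹)⁻¹ := by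
      rw [smul_inv', inv_inv, mul_inv, inv_inv]
    rw [this]
    exact inv_mem (ha δ)

/-- 1-cocycles with values in the subgroup `N` of `U`. -/
def Z1 (N : Subgroup U) : Subgroup (Δ → U) where
  carrier := {c | (∀ δ, c δ ∈ N) ∧ ∀ δ ε : Δ, c (δ * ε) = δ • c ε * c δ}
  one_mem' := ⟨fun _ => N.one_mem, by intro δ ε; simp⟩
  mul_mem' := by
    rintro a b ⟨haN, ha⟩ ⟨hbN, hb⟩
    refine ⟨fun δ => N.mul_mem (haN δ) (hbN δ), fun δ ε => ?_⟩
    simp only [Pi.mul_apply, ha δ ε, hb δ ε, smul_mul']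
    exact mul_mul_mul_comm _ _ _ _
  inv_mem' := by
    rintro a ⟨haN, ha⟩
    refine ⟨fun δ => N.inv_mem (haN δ), fun δ ε => ?_⟩
    simp only [Pi.inv_apply, ha δ ε, smul_inv', mul_inv]

/-- 1-coboundaries coming from elements of the subgroup `N` of `U`. -/
def B1 (N : Subgroup U) : Subgroup (Δ → U) where
  carrier := {c | ∃ u ∈ N, ∀ δ : Δ, c δ = δ • u * u⁻¹}
  one_mem' := ⟨1, N.one_mem, by simp⟩
  mul_mem' := by
    rintro a b ⟨ua, hua, ha⟩ ⟨ub, hub, hb⟩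
    refine ⟨ua * ub, N.mul_mem hua hub, fun δ => ?_⟩
    simp only [Pi.mul_apply, ha δ, hb δ, smul_mul', mul_inv]
    exact mul_mul_mul_comm _ _ _ _
  inv_mem' := by
    rintro a ⟨ua, hua, ha⟩
    refine ⟨ua⁻¹, N.inv_mem hua, fun δ => ?_⟩
    simp only [Pi.inv_apply, ha δ, smul_inv', mul_inv, inv_inv]

/-- First group cohomology `H¹(Δ, N)` for a (`Δ`-stable) subgroup `N` of `U`. -/
abbrev H1 (N : Subgroup U) := Z1 Δ U N ⧸ ((B1 Δ U N).subgroupOf (Z1 Δ U N))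

/-- 2-cocycles with values in the subgroup `N` of `U`. -/
def Z2 (N : Subgroup U) : Subgroup (Δ × Δ → U) where
  carrier := {c | (∀ p, c p ∈ N) ∧
    ∀ δ ε ζ : Δ, δ • c (ε, ζ) * (c (δ * ε, ζ))⁻¹ * c (δ, ε * ζ) * (c (δ, ε))⁻¹ = 1}
  one_mem' := ⟨fun _ => N.one_mem, by intro δ ε ζ; simp⟩
  mul_mem' := by
    rintro a b ⟨haN, ha⟩ ⟨hbN, hb⟩
    refine ⟨fun p => N.mul_mem (haN p) (hbN p), fun δ ε ζ => ?_⟩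
    have h1 := ha δ ε ζ
    have h2 := hb δ ε ζ
    simp only [Pi.mul_apply, smul_mul', mul_inv]
    calc δ • a (ε, ζ) * δ • b (ε, ζ) * ((a (δ * ε, ζ))⁻¹ * (b (δ * ε, ζ))⁻¹) *
          (a (δ, ε * ζ) * b (δ, ε * ζ)) * ((a (δ, ε))⁻¹ * (b (δ, ε))⁻¹)
        = (δ • a (ε, ζ) * (a (δ * ε, ζ))⁻¹ * a (δ, ε * ζ) * (a (δ, ε))⁻¹) *
          (δ • b (ε, ζ) * (b (δ * ε, ζ))⁻¹ * b (δ, ε * ζ) * (b (δ, ε))⁻¹) := by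
          simp only [mul_assoc, mul_left_comm, mul_comm]
      _ = 1 := by rw [h1, h2, one_mul]
  inv_mem' := by
    rintro a ⟨haN, ha⟩
    refine ⟨fun p => N.inv_mem (haN p), fun δ ε ζ => ?_⟩
    have h1 := ha δ ε ζ
    simp only [Pi.inv_apply, smul_inv', inv_inv]
    calc (δ • a (ε, ζ))⁻¹ * a (δ * ε, ζ) * (a (δ, ε * ζ))⁻¹ * a (δ, ε)
        = (δ • a (ε, ζ) * (a (δ * ε, ζ))⁻¹ * a (δ, ε * ζ) * (a (δ, ε))⁻¹)⁻¹ := by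
          simp [mul_inv, inv_inv, mul_assoc, mul_left_comm, mul_comm]
      _ = 1 := by rw [h1, inv_one]
/-- 2-coboundaries of cochains with values in the subgroup `N` of `U`. -/
def B2 (N : Subgroup U) : Subgroup (Δ × Δ → U) where
  carrier := {c | ∃ b : Δ → U, (∀ δ, b δ ∈ N) ∧
    ∀ δ ε : Δ, c (δ, ε) = δ • b ε * (b (δ * ε))⁻¹ * b δ}
  one_mem' := ⟨1, fun _ => N.one_mem, by intro δ ε; simp⟩
  mul_mem' := by
    rintro a b ⟨ba, hbaN, ha⟩ ⟨bb, hbbN, hb⟩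
    refine ⟨ba * bb, fun δ => N.mul_mem (hbaN δ) (hbbN δ), fun δ ε => ?_⟩
    simp only [Pi.mul_apply, ha δ ε, hb δ ε, smul_mul', mul_inv]
    simp only [mul_assoc, mul_left_comm, mul_comm]
  inv_mem' := by
    rintro a ⟨ba, hbaN, ha⟩
    refine ⟨ba⁻¹, fun δ => N.inv_mem (hbaN δ), fun δ ε => ?_⟩
    simp [Pi.inv_apply, ha δ ε, smul_inv', mul_inv, inv_inv, mul_assoc, mul_left_comm, mul_comm]

/-- Second group cohomology `H²(Δ, N)` for a (`Δ`-stable) subgroup `N` of `U`. -/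
abbrev H2 (N : Subgroup U) := Z2 Δ U N ⧸ ((B2 Δ U N).subgroupOf (Z2 Δ U N))

/-- The inclusion of cocycles valued in `N` into cocycles valued in `N'` for `N ≤ N'`. -/
def Z1incl {N N' : Subgroup U} (h : N ≤ N') : ↥(Z1 Δ U N) →* ↥(Z1 Δ U N') where
  toFun c := ⟨(c : Δ → U), ⟨fun δ => h (c.2.1 δ), c.2.2⟩⟩
  map_one' := rfl
  map_mul' _ _ := rfl

/-- The morphism `H¹(Δ, N) →* H¹(Δ, N')` induced by an inclusion `N ≤ N'`. -/
def H1incl {N N' : Subgroup U} (h : N ≤ N') : H1 Δ U N →* H1 Δ U N' :=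
  QuotientGroup.map _ _ (Z1incl Δ U h) (by
    rintro ⟨c, hc⟩ hmem
    rcases hmem with ⟨u, huN, hu⟩
    exact ⟨u, h huN, hu⟩)

end CapMul

open NumberField IsDedekindDomain CapMul

/-- The set of primes of `𝓞 K` lying over the primes of `S`. -/
def primesOver (F K : Type*) [Field F] [NumberField F] [Field K] [NumberField K] [Algebra F K]
    (S : Set (HeightOneSpectrum (𝓞 F))) : Set (HeightOneSpectrum (𝓞 K)) :=
  {w | ∃ v ∈ S, Ideal.comap (algebraMap (𝓞 F) (𝓞 K)) w.asIdeal = v.asIdeal}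

variable (F K : Type*) [Field F] [NumberField F] [Field K] [NumberField K] [Algebra F K]
  (S : Set (HeightOneSpectrum (𝓞 F)))

/-- The ring `O_{F,S}` of `S`-integers of `F`. -/
abbrev OFS := ↥(S.integer F)

/-- The ring `O_{K,S}` of `S_K`-integers of `K`. -/
abbrev OKS := ↥((primesOver F K S).integer K)

/-- The `S`-unit group `U_F`, viewed as a subgroup of `U_K = O_{K,S}ˣ` via the inclusion
`O_{F,S} → O_{K,S}`. -/
noncomputable def UF [Algebra (OFS F S) (OKS F K S)] : Subgroup (OKS F K S)ˣ :=
  (Units.map (algebraMap (OFS F S) (OKS F K S)).toMonoidHom).range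

namespace CapAux

variable {Δ U : Type*} [Group Δ] [CommGroup U] [MulDistribMulAction Δ U]

theorem mem_npow {n : ℕ} {u : U} : u ∈ npowSub U n ↔ ∃ v, v ^ n = u := by
  simp [npowSub, MonoidHom.mem_range]

theorem mem_ntors {n : ℕ} {u : U} : u ∈ ntors U n ↔ u ^ n = 1 := by
  simp [ntors, MonoidHom.mem_ker]

/-- The coboundary of an element. -/
def d0 (Δ : Type*) {U : Type*} [Group Δ] [CommGroup U] [MulDistribMulAction Δ U] :
    U →* (Δ → U) where
  toFun u := fun σ => σ • u * u⁻¹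
  map_one' := by ext; simp
  map_mul' a b := by
    ext σ
    simp only [Pi.mul_apply, smul_mul', mul_inv]
    exact mul_mul_mul_comm _ _ _ _

/-- The coboundary of a 1-cochain. -/
def d1 : (Δ → U) →* (Δ × Δ → U) where
  toFun c := fun p => p.1 • c p.2 * (c (p.1 * p.2))⁻¹ * c p.1
  map_one' := by ext; simp
  map_mul' a b := by
    ext σ
    simp only [Pi.mul_apply, smul_mul', mul_inv]
    simp only [mul_assoc, mul_left_comm, mul_comm]

theorem d0_apply (u : U) (σ : Δ) : d0 Δ u σ = σ • u * u⁻¹ := rfl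

theorem d1_apply (c : Δ → U) (σ τ : Δ) :
    d1 c (σ, τ) = σ • c τ * (c (σ * τ))⁻¹ * c σ := rfl

theorem d1_eq_one_iff (c : Δ → U) : d1 c = 1 ↔ ∀ σ τ : Δ, c (σ * τ) = σ • c τ * c σ := by
  constructor
  · intro h σ τ
    have := congrFun h (σ, τ)
    rw [d1_apply, Pi.one_apply, mul_right_comm, mul_inv_eq_one] at this
    exact this.symm
  · intro h
    ext ⟨σ, τ⟩
    rw [d1_apply, h, Pi.one_apply, mul_right_comm, mul_inv_cancel]

theorem d1_d0 (u : U) : d1 (d0 Δ u) = 1 := by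
  rw [d1_eq_one_iff]
  intro σ τ
  simp only [d0_apply, smul_mul', smul_inv', mul_smul]
  rw [← mul_assoc, inv_mul_cancel_right]

theorem d0_eq_one_iff (u : U) : d0 Δ u = 1 ↔ u ∈ invts Δ U := by
  constructor
  · intro h σ
    exact mul_inv_eq_one.1 (congrFun h σ)
  · intro h
    ext σ
    exact mul_inv_eq_one.2 (h σ)

theorem mem_Z1 {N : Subgroup U} {c : Δ → U} :
    c ∈ Z1 Δ U N ↔ (∀ σ, c σ ∈ N) ∧ d1 c = 1 := by
  rw [d1_eq_one_iff]; rfl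

theorem mem_B1 {N : Subgroup U} {c : Δ → U} :
    c ∈ B1 Δ U N ↔ ∃ u ∈ N, c = d0 Δ u := by
  constructor
  · rintro ⟨u, hu, h⟩; exact ⟨u, hu, funext h⟩
  · rintro ⟨u, hu, h⟩; exact ⟨u, hu, congrFun h⟩

theorem mem_B2 {N : Subgroup U} {c : Δ × Δ → U} :
    c ∈ B2 Δ U N ↔ ∃ b : Δ → U, (∀ σ, b σ ∈ N) ∧ c = d1 b := by
  constructor
  · rintro ⟨u, hu, h⟩; exact ⟨u, hu, funext fun p => h p.1 p.2⟩
  · rintro ⟨u, hu, h⟩; exact ⟨u, hu, fun σ τ => congrFun h (σ, τ)⟩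

theorem mem_psi {n : ℕ} {u : U} : u ∈ psi Δ U n ↔ ∃ c : Δ → U, c ^ n = d0 Δ u := by
  constructor
  · intro h
    choose c hc using fun σ => mem_npow.1 (h σ)
    exact ⟨c, funext hc⟩
  · rintro ⟨c, hc⟩ σ
    exact mem_npow.2 ⟨c σ, congrFun hc σ⟩

theorem d1_mem_Z2 {n : ℕ} {c : Δ → U} {u : U} (h : c ^ n = d0 Δ u) :
    d1 c ∈ Z2 Δ U (ntors U n) := by
  refine ⟨fun p => ?_, fun σ τ ρ => ?_⟩
  · rw [mem_ntors, ← Pi.pow_apply, ← map_pow, h, d1_d0, Pi.one_apply]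
  · simp only [d1_apply, smul_mul', smul_inv', mul_smul, mul_inv, inv_inv, mul_assoc σ τ ρ]
    generalize σ • τ • c ρ = a
    generalize σ • c (τ * ρ) = b
    generalize σ • c τ = d
    generalize c (σ * (τ * ρ)) = e
    generalize c (σ * τ) = f
    generalize c σ = g
    apply Additive.ofMul.injective
    simp only [ofMul_mul, ofMul_inv, ofMul_one]
    abel

theorem mk_eq_one {G : Type*} [CommGroup G] {N : Subgroup G} (x : G) :
    (QuotientGroup.mk x : G ⧸ N) = 1 ↔ x ∈ N := QuotientGroup.eq_one_iff x

theorem mk_eq_mk {G : Type*} [CommGroup G] {N : Subgroup G} (x y : G) :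
    (QuotientGroup.mk x : G ⧸ N) = QuotientGroup.mk y ↔ x / y ∈ N :=
  QuotientGroup.eq_iff_div_mem

/-- A homomorphism obtained from a relation. -/
theorem exists_hom {A B : Type*} [Group A] [Group B] (R : A → B → Prop)
    (hex : ∀ a, ∃ b, R a b) (hu : ∀ a b b', R a b → R a b' → b = b')
    (hm : ∀ a a' b b', R a b → R a' b' → R (a * a') (b * b')) :
    ∃ f : A →* B, ∀ a b, R a b → f a = b := by
  choose f hf using hex
  exact ⟨MonoidHom.mk' f fun a b => hu _ _ _ (hf _) (hm _ _ _ _ (hf a) (hf b)),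
    fun a b h => hu _ _ _ (hf a) h⟩

/-- A homomorphism on a quotient obtained from a relation. -/
theorem exists_lift {A B : Type*} [CommGroup A] [Group B] (N : Subgroup A) (R : A → B → Prop)
    (hex : ∀ a, ∃ b, R a b) (hu : ∀ a b b', R a b → R a b' → b = b')
    (hm : ∀ a a' b b', R a b → R a' b' → R (a * a') (b * b')) (h1 : ∀ a ∈ N, R a 1) :
    ∃ f : (A ⧸ N) →* B, ∀ a b, R a b → f (QuotientGroup.mk a) = b := by
  obtain ⟨f, hf⟩ := exists_hom R hex hu hm
  exact ⟨QuotientGroup.lift N f fun a ha => hf _ _ (h1 a ha), fun a b h => hf a b h⟩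

theorem d0_pow_prod [Fintype Δ] (c : Δ → U) (h : d1 c = 1) :
    c ^ Fintype.card Δ = d0 Δ (∏ τ, c τ)⁻¹ := by
  rw [d1_eq_one_iff] at h
  ext σ
  have h1 : ∏ τ, c τ = σ • (∏ τ, c τ) * c σ ^ Fintype.card Δ := by
    refine (Equiv.prod_comp (Equiv.mulLeft σ) c).symm.trans ?_
    simp only [Equiv.coe_mulLeft, h, Finset.prod_mul_distrib, Finset.prod_const, Finset.card_univ,
      Finset.smul_prod']
  rw [d0_apply, smul_inv', inv_inv, Pi.pow_apply, eq_inv_mul_iff_mul_eq]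
  exact h1.symm

theorem d0_smul_pow (u : U) (n : ℕ) : d0 Δ (u ^ n) = (d0 Δ u) ^ n := map_pow _ _ _

theorem main [Fintype Δ] (n : ℕ) (hcard : Fintype.card Δ = n) (V : Subgroup U)
    (hV : V = invts Δ U) :
    ∃ (φ₁ : (↥(V ⊓ npowSub U n) ⧸
        ((Subgroup.map (powMonoidHom n) V).subgroupOf (V ⊓ npowSub U n))) →*
        H1 Δ U (ntors U n))
      (φ₂ : H1 Δ U (ntors U n) →* H1 Δ U ⊤)
      (φ₃ : H1 Δ U ⊤ →* (↥(psi Δ U n) ⧸ ((V ⊔ npowSub U n).subgroupOf (psi Δ U n))))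
      (φ₄ : (↥(psi Δ U n) ⧸ ((V ⊔ npowSub U n).subgroupOf (psi Δ U n))) →*
        H2 Δ U (ntors U n)),
      Function.Injective φ₁ ∧
      φ₁.range = φ₂.ker ∧ φ₂.range = φ₃.ker ∧ φ₃.range = φ₄.ker ∧
      (∀ (u : U) (x : ↥(V ⊓ npowSub U n)), (x : U) = u ^ n →
        ∀ c : ↥(Z1 Δ U (ntors U n)), (∀ σ : Δ, (c : Δ → U) σ = σ • u * u⁻¹) →
            φ₁ (QuotientGroup.mk x) = QuotientGroup.mk c) ∧
      (∀ (c : ↥(Z1 Δ U (ntors U n))) (c' : ↥(Z1 Δ U ⊤)),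
        (c : Δ → U) = (c' : Δ → U) →
          φ₂ (QuotientGroup.mk c) = QuotientGroup.mk c') ∧
      (∀ c : ↥(Z1 Δ U ⊤), ∃ b : ↥(psi Δ U n),
        ∀ σ : Δ, (c : Δ → U) σ ^ n = σ • (b : U) * (b : U)⁻¹) ∧
      (∀ (c : ↥(Z1 Δ U ⊤)) (b : ↥(psi Δ U n)),
        (∀ σ : Δ, (c : Δ → U) σ ^ n = σ • (b : U) * (b : U)⁻¹) →
          φ₃ (QuotientGroup.mk c) = QuotientGroup.mk b) ∧
      (∀ b : ↥(psi Δ U n), ∃ c : Δ → U, ∀ σ : Δ, c σ ^ n = σ • (b : U) * (b : U)⁻¹) ∧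
      (∀ (b : ↥(psi Δ U n)) (c : Δ → U),
        (∀ σ : Δ, c σ ^ n = σ • (b : U) * (b : U)⁻¹) →
        (fun p : Δ × Δ => p.1 • c p.2 * (c (p.1 * p.2))⁻¹ * c p.1) ∈ Z2 Δ U (ntors U n)) ∧
      (∀ (b : ↥(psi Δ U n)) (c : Δ → U),
        (∀ σ : Δ, c σ ^ n = σ • (b : U) * (b : U)⁻¹) →
        ∀ z : ↥(Z2 Δ U (ntors U n)),
          (∀ p : Δ × Δ, (z : Δ × Δ → U) p = p.1 • c p.2 * (c (p.1 * p.2))⁻¹ * c p.1) →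
            φ₄ (QuotientGroup.mk b) = QuotientGroup.mk z) := by
  have hV' : ∀ u, u ∈ V ↔ d0 Δ u = 1 := fun u => by rw [hV, d0_eq_one_iff]
  have hsup : ∀ u, u ∈ V ⊔ npowSub U n ↔ ∃ v, d0 Δ u = d0 Δ v ^ n := by
    intro u
    constructor
    · intro h
      obtain ⟨a, ha, b, hb, rfl⟩ := Subgroup.mem_sup.1 h
      obtain ⟨v, rfl⟩ := mem_npow.1 hb
      exact ⟨v, by rw [map_mul, (hV' a).1 ha, one_mul, map_pow]⟩
    · rintro ⟨v, hv⟩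
      refine Subgroup.mem_sup.2 ⟨u / v ^ n, (hV' _).2 ?_, v ^ n, mem_npow.2 ⟨v, rfl⟩,
        div_mul_cancel _ _⟩
      rw [map_div, hv, map_pow, div_self']
  -- cocycle from `u` with `u ^ n` invariant
  have hz : ∀ u : U, u ^ n ∈ V → d0 Δ u ∈ Z1 Δ U (ntors U n) := by
    intro u hu
    refine mem_Z1.2 ⟨fun σ => ?_, d1_d0 u⟩
    rw [mem_ntors, ← Pi.pow_apply, ← map_pow, (hV' _).1 hu, Pi.one_apply]
  -- the norm argument
  have hb : ∀ c : ↥(Z1 Δ U ⊤), ∃ b : ↥(psi Δ U n), (c : Δ → U) ^ n = d0 Δ (b : U) := by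
    intro c
    have h := d0_pow_prod (c : Δ → U) (mem_Z1.1 c.2).2
    rw [hcard] at h
    exact ⟨⟨_, mem_psi.2 ⟨_, h⟩⟩, h⟩
  obtain ⟨φ₁, h₁⟩ := exists_lift
    ((Subgroup.map (powMonoidHom n) V).subgroupOf (V ⊓ npowSub U n))
    (fun (x : ↥(V ⊓ npowSub U n)) (y : H1 Δ U (ntors U n)) =>
      ∃ (u : U) (c : ↥(Z1 Δ U (ntors U n))), (x : U) = u ^ n ∧ (c : Δ → U) = d0 Δ u ∧
        y = QuotientGroup.mk c)
    (by
      rintro ⟨x, hx, hx'⟩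
      obtain ⟨u, rfl⟩ := mem_npow.1 hx'
      exact ⟨_, u, ⟨d0 Δ u, hz u hx⟩, rfl, rfl, rfl⟩)
    (by
      rintro x _ _ ⟨u, c, hu, hc, rfl⟩ ⟨u', c', hu', hc', rfl⟩
      rw [mk_eq_mk, Subgroup.mem_subgroupOf, mem_B1]
      refine ⟨u / u', mem_ntors.2 ?_, ?_⟩
      · rw [div_pow, ← hu, ← hu', div_self']
      · rw [Subgroup.coe_div, hc, hc', map_div])
    (by
      rintro x x' _ _ ⟨u, c, hu, hc, rfl⟩ ⟨u', c', hu', hc', rfl⟩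
      refine ⟨u * u', c * c', ?_, ?_, rfl⟩
      · rw [Subgroup.coe_mul, hu, hu', mul_pow]
      · rw [Subgroup.coe_mul, hc, hc', map_mul])
    (by
      rintro x hx
      obtain ⟨u, hu, hux⟩ := Subgroup.mem_map.1 (Subgroup.mem_subgroupOf.1 hx)
      exact ⟨u, 1, hux.symm, ((hV' u).1 hu).symm, rfl⟩)
  obtain ⟨φ₃, h₃⟩ := exists_lift ((B1 Δ U ⊤).subgroupOf (Z1 Δ U ⊤))
    (fun (c : ↥(Z1 Δ U ⊤)) (y : ↥(psi Δ U n) ⧸ ((V ⊔ npowSub U n).subgroupOf (psi Δ U n))) =>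
      ∃ b : ↥(psi Δ U n), (c : Δ → U) ^ n = d0 Δ (b : U) ∧ y = QuotientGroup.mk b)
    (by
      intro c
      obtain ⟨b, h⟩ := hb c
      exact ⟨_, b, h, rfl⟩)
    (by
      rintro c _ _ ⟨b, h, rfl⟩ ⟨b', h', rfl⟩
      rw [mk_eq_mk, Subgroup.mem_subgroupOf, hsup]
      exact ⟨1, by rw [Subgroup.coe_div, map_div, ← h, ← h', div_self', map_one, one_pow]⟩)
    (by
      rintro c c' _ _ ⟨b, h, rfl⟩ ⟨b', h', rfl⟩
      exact ⟨b * b', by rw [Subgroup.coe_mul, Subgroup.coe_mul, mul_pow, h, h', map_mul], rfl⟩)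
    (by
      intro c hc
      obtain ⟨u, -, hu⟩ := mem_B1.1 (Subgroup.mem_subgroupOf.1 hc)
      have h : (c : Δ → U) ^ n = d0 Δ (u ^ n) := by rw [hu, map_pow]
      refine ⟨⟨u ^ n, mem_psi.2 ⟨_, h⟩⟩, h, ?_⟩
      symm
      rw [mk_eq_one, Subgroup.mem_subgroupOf, hsup]
      exact ⟨u, map_pow _ _ _⟩)
  obtain ⟨φ₄, h₄⟩ := exists_lift ((V ⊔ npowSub U n).subgroupOf (psi Δ U n))
    (fun (b : ↥(psi Δ U n)) (y : H2 Δ U (ntors U n)) =>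
      ∃ (c : Δ → U) (z : ↥(Z2 Δ U (ntors U n))), c ^ n = d0 Δ (b : U) ∧
        (z : Δ × Δ → U) = d1 c ∧ y = QuotientGroup.mk z)
    (by
      intro b
      obtain ⟨c, hc⟩ := mem_psi.1 b.2
      exact ⟨_, c, ⟨d1 c, d1_mem_Z2 hc⟩, hc, rfl, rfl⟩)
    (by
      rintro b _ _ ⟨c, z, h, hz, rfl⟩ ⟨c', z', h', hz', rfl⟩
      rw [mk_eq_mk, Subgroup.mem_subgroupOf, mem_B2]
      refine ⟨c / c', fun σ => mem_ntors.2 ?_, by rw [Subgroup.coe_div, hz, hz', map_div]⟩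
      rw [← Pi.pow_apply, div_pow, h, h', div_self', Pi.one_apply])
    (by
      rintro b b' _ _ ⟨c, z, h, hz, rfl⟩ ⟨c', z', h', hz', rfl⟩
      refine ⟨c * c', z * z', ?_, ?_, rfl⟩
      · rw [Subgroup.coe_mul, mul_pow, h, h', map_mul]
      · rw [Subgroup.coe_mul, hz, hz', map_mul])
    (by
      intro b hb
      obtain ⟨v, hv⟩ := (hsup _).1 (Subgroup.mem_subgroupOf.1 hb)
      exact ⟨d0 Δ v, 1, hv.symm, (d1_d0 v).symm, rfl⟩)
  refine ⟨φ₁, H1incl Δ U le_top, φ₃, φ₄, ?_, ?_, ?_, ?_, ?_, ?_, ?_, ?_, ?_, ?_, ?_⟩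
  · rw [injective_iff_map_eq_one]
    intro y hy
    obtain ⟨⟨x, hx, hx'⟩, rfl⟩ := QuotientGroup.mk_surjective y
    obtain ⟨u, rfl⟩ := mem_npow.1 hx'
    rw [h₁ _ _ ⟨u, ⟨d0 Δ u, hz u hx⟩, rfl, rfl, rfl⟩, mk_eq_one, Subgroup.mem_subgroupOf,
      mem_B1] at hy
    obtain ⟨v, hv, hvu⟩ := hy
    rw [mk_eq_one, Subgroup.mem_subgroupOf, Subgroup.mem_map]
    refine ⟨u / v, (hV' _).2 ?_, ?_⟩
    · rw [map_div]
      exact div_eq_one.2 hvu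
    · change (u / v) ^ n = u ^ n
      rw [div_pow, mem_ntors.1 hv, div_one]
  · ext y
    rw [MonoidHom.mem_range, MonoidHom.mem_ker]
    constructor
    · rintro ⟨x, rfl⟩
      obtain ⟨⟨x, hx, hx'⟩, rfl⟩ := QuotientGroup.mk_surjective x
      obtain ⟨u, rfl⟩ := mem_npow.1 hx'
      rw [h₁ _ _ ⟨u, ⟨d0 Δ u, hz u hx⟩, rfl, rfl, rfl⟩]
      exact (mk_eq_one _).2 (Subgroup.mem_subgroupOf.2 (mem_B1.2 ⟨u, trivial, rfl⟩))
    · intro hy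
      obtain ⟨c, rfl⟩ := QuotientGroup.mk_surjective y
      obtain ⟨u, -, hu⟩ := mem_B1.1 (Subgroup.mem_subgroupOf.1 ((mk_eq_one _).1 hy))
      replace hu : (c : Δ → U) = d0 Δ u := hu
      refine ⟨QuotientGroup.mk ⟨u ^ n, (hV' _).2 ?_, mem_npow.2 ⟨u, rfl⟩⟩,
        h₁ _ _ ⟨u, c, rfl, hu, rfl⟩⟩
      rw [map_pow, ← hu]
      ext σ
      exact mem_ntors.1 ((mem_Z1.1 c.2).1 σ)
  · ext y
    rw [MonoidHom.mem_range, MonoidHom.mem_ker]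
    constructor
    · rintro ⟨x, rfl⟩
      obtain ⟨c, rfl⟩ := QuotientGroup.mk_surjective x
      refine h₃ _ _ ⟨1, ?_, rfl⟩
      ext σ
      have h1 : d0 Δ (1 : U) σ = 1 := by rw [map_one, Pi.one_apply]
      exact (mem_ntors.1 ((mem_Z1.1 c.2).1 σ)).trans h1.symm
    · intro hy
      obtain ⟨c, rfl⟩ := QuotientGroup.mk_surjective y
      obtain ⟨b, h⟩ := hb c
      rw [h₃ _ _ ⟨b, h, rfl⟩, mk_eq_one, Subgroup.mem_subgroupOf, hsup] at hy
      obtain ⟨v, hv⟩ := hy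
      have hc : (c : Δ → U) / d0 Δ v ∈ Z1 Δ U (ntors U n) := by
        refine mem_Z1.2 ⟨fun σ => mem_ntors.2 ?_, ?_⟩
        · rw [← Pi.pow_apply, div_pow, h, hv, div_self', Pi.one_apply]
        · rw [map_div, d1_d0, (mem_Z1.1 c.2).2, div_one]
      refine ⟨QuotientGroup.mk ⟨_, hc⟩, ?_⟩
      refine (mk_eq_mk _ _).2 (Subgroup.mem_subgroupOf.2 (mem_B1.2 ⟨v⁻¹, trivial, ?_⟩))
      rw [map_inv]
      change (c : Δ → U) / d0 Δ v / (c : Δ → U) = _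
      rw [div_div_cancel_left]
  · ext y
    rw [MonoidHom.mem_range, MonoidHom.mem_ker]
    constructor
    · rintro ⟨x, rfl⟩
      obtain ⟨c, rfl⟩ := QuotientGroup.mk_surjective x
      obtain ⟨b, h⟩ := hb c
      rw [h₃ _ _ ⟨b, h, rfl⟩]
      exact h₄ _ _ ⟨c, 1, h, (mem_Z1.1 c.2).2.symm, rfl⟩
    · intro hy
      obtain ⟨b, rfl⟩ := QuotientGroup.mk_surjective y
      obtain ⟨c, hc⟩ := mem_psi.1 b.2
      rw [h₄ _ _ ⟨c, ⟨d1 c, d1_mem_Z2 hc⟩, hc, rfl, rfl⟩, mk_eq_one, Subgroup.mem_subgroupOf,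
        mem_B2] at hy
      obtain ⟨e, he, hce⟩ := hy
      replace hce : d1 c = d1 e := hce
      have hc' : c / e ∈ Z1 Δ U ⊤ :=
        mem_Z1.2 ⟨fun σ => trivial, by rw [map_div, hce, div_self']⟩
      refine ⟨QuotientGroup.mk ⟨_, hc'⟩, h₃ _ _ ⟨b, ?_, rfl⟩⟩
      change (c / e) ^ n = _
      have : e ^ n = 1 := funext fun σ => mem_ntors.1 (he σ)
      rw [div_pow, hc, this, div_one]
  · intro u x hx c hc
    exact h₁ _ _ ⟨u, c, hx, funext hc, rfl⟩
  · intro c c' h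
    have : Z1incl Δ U le_top c = c' := Subtype.ext h
    rw [← this]
    rfl
  · intro c
    obtain ⟨b, h⟩ := hb c
    exact ⟨b, congrFun h⟩
  · intro c b h
    exact h₃ _ _ ⟨b, funext h, rfl⟩
  · intro b
    obtain ⟨c, hc⟩ := mem_psi.1 b.2
    exact ⟨c, congrFun hc⟩
  · intro b c h
    exact d1_mem_Z2 (u := (b : U)) (funext h)
  · intro b c h z hz
    exact h₄ _ _ ⟨c, z, funext h, funext hz, rfl⟩

end CapAux

theorem mem_integer_descend (x : F)
    (hx : algebraMap F K x ∈ (primesOver F K S).integer K) : x ∈ S.integer F := by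
  intro v hv
  obtain ⟨P, hPm, hP⟩ := Ideal.exists_maximal_ideal_liesOver_of_isIntegral (S := 𝓞 K) v.asIdeal
  have hbot : P ≠ ⊥ := Ideal.ne_bot_of_liesOver_of_ne_bot v.ne_bot P
  let w : HeightOneSpectrum (𝓞 K) := ⟨P, hPm.isPrime, hbot⟩
  haveI : w.asIdeal.LiesOver v.asIdeal := hP
  have hw : w ∉ primesOver F K S := by
    rintro ⟨v', hv', h⟩
    apply hv
    have h2 : v.asIdeal = v'.asIdeal := by rw [← h]; exact hP.over
    rwa [HeightOneSpectrum.ext h2]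
  have h := hx w hw
  rw [← HeightOneSpectrum.valuation_liesOver K v w] at h
  have he : v.asIdeal.ramificationIdx' w.asIdeal ≠ 0 :=
    Ideal.IsDedekindDomain.ramificationIdx'_ne_zero_of_liesOver _ v.ne_bot
  exact (pow_le_one_iff he).1 h

theorem UF_eq_invts [IsGalois F K] [Algebra (OFS F S) (OKS F K S)]
    (hAB : ∀ a : OFS F S, ((algebraMap (OFS F S) (OKS F K S) a : OKS F K S) : K) =
      algebraMap F K (a : F))
    [MulDistribMulAction (K ≃ₐ[F] K) (OKS F K S)ˣ]
    (hact : ∀ (σ : K ≃ₐ[F] K) (u : (OKS F K S)ˣ),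
      (((σ • u : (OKS F K S)ˣ) : OKS F K S) : K) = σ ((u : OKS F K S) : K)) :
    UF F K S = invts (K ≃ₐ[F] K) (OKS F K S)ˣ := by
  haveI : FiniteDimensional F K := Module.Finite.of_restrictScalars_finite ℚ F K
  have key : ∀ u : (OKS F K S)ˣ, u ∈ invts (K ≃ₐ[F] K) (OKS F K S)ˣ →
      ∃ a : OFS F S, algebraMap (OFS F S) (OKS F K S) a = (u : OKS F K S) := by
    intro u hu
    obtain ⟨x, hx⟩ := (IsGalois.mem_range_algebraMap_iff_fixed (F := F) ((u : OKS F K S) : K)).2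
      (fun σ => by rw [← hact, hu σ])
    refine ⟨⟨x, mem_integer_descend F K S x ?_⟩, ?_⟩
    · rw [hx]; exact (u : OKS F K S).2
    · apply Subtype.ext
      rw [hAB]
      exact hx
  have hinj : Function.Injective (algebraMap (OFS F S) (OKS F K S)) := by
    intro a b h
    apply Subtype.ext
    apply (algebraMap F K).injective
    rw [← hAB, ← hAB, h]
  ext u
  constructor
  · rintro ⟨a, rfl⟩ σ
    apply Units.ext
    apply Subtype.ext
    rw [hact]
    change σ ((algebraMap (OFS F S) (OKS F K S) (a : OFS F S) : OKS F K S) : K) =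
      ((algebraMap (OFS F S) (OKS F K S) (a : OFS F S) : OKS F K S) : K)
    rw [hAB]
    exact σ.commutes _
  · intro hu
    obtain ⟨a, ha⟩ := key u hu
    obtain ⟨b, hb⟩ := key u⁻¹ (inv_mem hu)
    have hab : a * b = 1 := hinj (by rw [map_mul, ha, hb, map_one, Units.mul_inv])
    exact ⟨⟨a, b, hab, by rw [mul_comm, hab]⟩, Units.ext ha⟩

/-- For a finite Galois extension `K/F` of number fields with group `Δ` of
order `n ≥ 2` and a finite set `S` of primes of `F`, there is an exact sequence
`1 → (U_F ∩ U_Kⁿ)/U_Fⁿ → H¹(Δ, μ_n(K)) → H¹(Δ, U_K) → Ψ(K/F,S)/(U_F·U_Kⁿ) → H²(Δ, μ_n(K))`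
with the maps described explicitly as in the paper (`μ_n(K)` being identified with the
`n`-torsion subgroup of `U_K`). -/
theorem stmt9 [IsGalois F K] [Fintype (K ≃ₐ[F] K)] (n : ℕ)
    (hcard : Fintype.card (K ≃ₐ[F] K) = n) (hn : 2 ≤ n) (hS : S.Finite)
    [Algebra (OFS F S) (OKS F K S)]
    (hAB : ∀ a : OFS F S, ((algebraMap (OFS F S) (OKS F K S) a : OKS F K S) : K) =
      algebraMap F K (a : F))
    [MulDistribMulAction (K ≃ₐ[F] K) (OKS F K S)ˣ]
    (hact : ∀ (σ : K ≃ₐ[F] K) (u : (OKS F K S)ˣ),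
      (((σ • u : (OKS F K S)ˣ) : OKS F K S) : K) = σ ((u : OKS F K S) : K)) :
    ∃ (φ₁ : (↥(UF F K S ⊓ npowSub (OKS F K S)ˣ n) ⧸
        ((Subgroup.map (powMonoidHom n) (UF F K S)).subgroupOf
          (UF F K S ⊓ npowSub (OKS F K S)ˣ n))) →*
        H1 (K ≃ₐ[F] K) (OKS F K S)ˣ (ntors (OKS F K S)ˣ n))
      (φ₂ : H1 (K ≃ₐ[F] K) (OKS F K S)ˣ (ntors (OKS F K S)ˣ n) →*
        H1 (K ≃ₐ[F] K) (OKS F K S)ˣ ⊤)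
      (φ₃ : H1 (K ≃ₐ[F] K) (OKS F K S)ˣ ⊤ →*
        (↥(psi (K ≃ₐ[F] K) (OKS F K S)ˣ n) ⧸
          ((UF F K S ⊔ npowSub (OKS F K S)ˣ n).subgroupOf
            (psi (K ≃ₐ[F] K) (OKS F K S)ˣ n))))
      (φ₄ : (↥(psi (K ≃ₐ[F] K) (OKS F K S)ˣ n) ⧸
          ((UF F K S ⊔ npowSub (OKS F K S)ˣ n).subgroupOf
            (psi (K ≃ₐ[F] K) (OKS F K S)ˣ n))) →*
        H2 (K ≃ₐ[F] K) (OKS F K S)ˣ (ntors (OKS F K S)ˣ n)),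
      -- exactness of 1 → • → • → • → • → •
      Function.Injective φ₁ ∧
      φ₁.range = φ₂.ker ∧ φ₂.range = φ₃.ker ∧ φ₃.range = φ₄.ker ∧
      -- φ₁ sends the class of `a = uⁿ ∈ U_F ∩ U_Kⁿ` to the class of `σ ↦ σ(u)·u⁻¹`
      (∀ (u : (OKS F K S)ˣ) (x : ↥(UF F K S ⊓ npowSub (OKS F K S)ˣ n)),
        (x : (OKS F K S)ˣ) = u ^ n →
        ∀ c : ↥(Z1 (K ≃ₐ[F] K) (OKS F K S)ˣ (ntors (OKS F K S)ˣ n)),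
          (∀ σ : K ≃ₐ[F] K, (c : (K ≃ₐ[F] K) → (OKS F K S)ˣ) σ = σ • u * u⁻¹) →
            φ₁ (QuotientGroup.mk x) = QuotientGroup.mk c) ∧
      -- φ₂ is induced by the inclusion μ_n(K) ⊆ U_K
      (∀ (c : ↥(Z1 (K ≃ₐ[F] K) (OKS F K S)ˣ (ntors (OKS F K S)ˣ n)))
         (c' : ↥(Z1 (K ≃ₐ[F] K) (OKS F K S)ˣ ⊤)),
        (c : (K ≃ₐ[F] K) → (OKS F K S)ˣ) = (c' : (K ≃ₐ[F] K) → (OKS F K S)ˣ) →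
          φ₂ (QuotientGroup.mk c) = QuotientGroup.mk c') ∧
      -- for each 1-cocycle c there is b ∈ Ψ(K/F,S) with c(σ)ⁿ = σ(b)·b⁻¹ for all σ,
      -- and φ₃ sends the class of c to the class of any such b
      (∀ c : ↥(Z1 (K ≃ₐ[F] K) (OKS F K S)ˣ ⊤), ∃ b : ↥(psi (K ≃ₐ[F] K) (OKS F K S)ˣ n),
        ∀ σ : K ≃ₐ[F] K, (c : (K ≃ₐ[F] K) → (OKS F K S)ˣ) σ ^ n =
          σ • (b : (OKS F K S)ˣ) * (b : (OKS F K S)ˣ)⁻¹) ∧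
      (∀ (c : ↥(Z1 (K ≃ₐ[F] K) (OKS F K S)ˣ ⊤)) (b : ↥(psi (K ≃ₐ[F] K) (OKS F K S)ˣ n)),
        (∀ σ : K ≃ₐ[F] K, (c : (K ≃ₐ[F] K) → (OKS F K S)ˣ) σ ^ n =
          σ • (b : (OKS F K S)ˣ) * (b : (OKS F K S)ˣ)⁻¹) →
          φ₃ (QuotientGroup.mk c) = QuotientGroup.mk b) ∧
      -- for every b ∈ Ψ(K/F,S) there is a cochain c with c(σ)ⁿ = σ(b)·b⁻¹, any such c
      -- yields a 2-cocycle valued in μ_n(K), and φ₄ sends the class of b to its class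
      (∀ b : ↥(psi (K ≃ₐ[F] K) (OKS F K S)ˣ n), ∃ c : (K ≃ₐ[F] K) → (OKS F K S)ˣ,
        ∀ σ : K ≃ₐ[F] K, c σ ^ n = σ • (b : (OKS F K S)ˣ) * (b : (OKS F K S)ˣ)⁻¹) ∧
      (∀ (b : ↥(psi (K ≃ₐ[F] K) (OKS F K S)ˣ n)) (c : (K ≃ₐ[F] K) → (OKS F K S)ˣ),
        (∀ σ : K ≃ₐ[F] K, c σ ^ n = σ • (b : (OKS F K S)ˣ) * (b : (OKS F K S)ˣ)⁻¹) →
        (fun p : (K ≃ₐ[F] K) × (K ≃ₐ[F] K) => p.1 • c p.2 * (c (p.1 * p.2))⁻¹ * c p.1) ∈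
          Z2 (K ≃ₐ[F] K) (OKS F K S)ˣ (ntors (OKS F K S)ˣ n)) ∧
      (∀ (b : ↥(psi (K ≃ₐ[F] K) (OKS F K S)ˣ n)) (c : (K ≃ₐ[F] K) → (OKS F K S)ˣ),
        (∀ σ : K ≃ₐ[F] K, c σ ^ n = σ • (b : (OKS F K S)ˣ) * (b : (OKS F K S)ˣ)⁻¹) →
        ∀ z : ↥(Z2 (K ≃ₐ[F] K) (OKS F K S)ˣ (ntors (OKS F K S)ˣ n)),
          (∀ p : (K ≃ₐ[F] K) × (K ≃ₐ[F] K),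
            (z : (K ≃ₐ[F] K) × (K ≃ₐ[F] K) → (OKS F K S)ˣ) p =
              p.1 • c p.2 * (c (p.1 * p.2))⁻¹ * c p.1) →
            φ₄ (QuotientGroup.mk b) = QuotientGroup.mk z) := by
  exact CapAux.main n hcard (UF F K S) (UF_eq_invts F K S hAB hact)
end

section
/- The set of ideal classes of O_{F,S} that capitulate in K is the underlying set of a subgroup of ClassGroup(O_{F,S}), and this subgroup is isomorphic, as an abelian group, to the quotient Ȟ¹(B/A, 𝔾ₘ) := Ker[d₂ : (B ⊗_A B)ˣ → (B ⊗_A B ⊗_A B)ˣ] / Im[d₁ : Bˣ → (B ⊗_A B)ˣ], where A = O_{F,S} and B = O_{K,S}. -/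
open CapCech

open NumberField IsDedekindDomain
open scoped nonZeroDivisors

variable (F K : Type*) [Field F] [NumberField F] [Field K] [NumberField K] [Algebra F K]
  (S : Set (HeightOneSpectrum (𝓞 F)))

/-- The set of ideal classes of `O_{F,S}` that capitulate in `K`: classes of nonzero ideals
`I` of `O_{F,S}` such that the extended ideal `I·O_{K,S}` is principal. -/
def capSet [IsDedekindDomain (OFS F S)] [Algebra (OFS F S) (OKS F K S)] :
    Set (ClassGroup (OFS F S)) :=
  {c | ∃ I : (Ideal (OFS F S))⁰, ClassGroup.mk0 I = c ∧
    (Ideal.map (algebraMap (OFS F S) (OKS F K S)) (I : Ideal (OFS F S))).IsPrincipal}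

namespace CapProof

open CapCech TensorProduct nonZeroDivisors

noncomputable section

/-- Two homomorphisms from a monoid with the same fibres have isomorphic images. -/
theorem glue {M G Q : Type*} [Monoid M] [Group G] [Group Q] (φ : M →* G) (ψ : M →* Q)
    (hψ : Function.Surjective ψ) (h : ∀ m n, φ m = φ n ↔ ψ m = ψ n) :
    ∃ H : Subgroup G, (H : Set G) = Set.range φ ∧ Nonempty (↥H ≃* Q) := by
  let s : Q → M := Function.surjInv hψ
  have hs : ∀ q, ψ (s q) = q := Function.surjInv_eq hψ
  let f : Q →* G := MonoidHom.mk' (fun q => φ (s q)) (by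
    intro a b
    rw [← map_mul, h, map_mul, hs, hs, hs])
  have hf : Function.Injective f := by
    intro a b hab
    have := (h _ _).1 hab
    rwa [hs, hs] at this
  refine ⟨f.range, ?_, ⟨(MonoidHom.ofInjective hf).symm⟩⟩
  ext x
  constructor
  · rintro ⟨q, rfl⟩
    exact ⟨s q, rfl⟩
  · rintro ⟨m, rfl⟩
    exact ⟨ψ m, (h _ _).2 (hs _)⟩

variable (A B : Type*) [CommRing A] [CommRing B] [Algebra A B]

/-- left inclusion -/
abbrev iL : B →ₐ[A] T2 A B := Algebra.TensorProduct.includeLeft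
/-- right inclusion -/
abbrev iR : B →ₐ[A] T2 A B := Algebra.TensorProduct.includeRight

variable {A B}

theorem q12_iL (b : B) : q12 A B (iL A B b) = b ⊗ₜ (1 ⊗ₜ 1) := by
  simp [q12, iL]
theorem q12_iR (b : B) : q12 A B (iR A B b) = 1 ⊗ₜ (b ⊗ₜ 1) := by
  simp [q12, iR]
theorem q13_iL (b : B) : q13 A B (iL A B b) = b ⊗ₜ (1 ⊗ₜ 1) := by
  simp [q13, iL]
theorem q13_iR (b : B) : q13 A B (iR A B b) = 1 ⊗ₜ (1 ⊗ₜ b) := by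
  simp [q13, iR]
theorem q23_iL (b : B) : q23 A B (iL A B b) = 1 ⊗ₜ (b ⊗ₜ 1) := by
  simp [q23, iL]
theorem q23_iR (b : B) : q23 A B (iR A B b) = 1 ⊗ₜ (1 ⊗ₜ b) := by
  simp [q23, iR]

theorem unit_aux {T : Type*} [CommRing T] (x y z : Tˣ) :
    x * y⁻¹ * z = 1 ↔ (z : T) * x = y := by
  rw [mul_right_comm, mul_inv_eq_one, Units.ext_iff, Units.val_mul, mul_comm]

theorem mem_ker_d2 (ξ : (T2 A B)ˣ) : ξ ∈ (d2 A B).ker ↔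
    q12 A B ξ * q23 A B ξ = q13 A B ξ := by
  rw [MonoidHom.mem_ker]
  have : d2 A B ξ = Units.map (q23 A B).toRingHom.toMonoidHom ξ *
      (Units.map (q13 A B).toRingHom.toMonoidHom ξ)⁻¹ *
    Units.map (q12 A B).toRingHom.toMonoidHom ξ := rfl
  rw [this, unit_aux]
  rfl

theorem d1_spec (u : Bˣ) : (d1 A B u : T2 A B) * iR A B u = iL A B u := by
  have : d1 A B u = Units.map (iL A B).toRingHom.toMonoidHom u /
    Units.map (iR A B).toRingHom.toMonoidHom u := rfl
  have h2 : d1 A B u * Units.map (iR A B).toRingHom.toMonoidHom u =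
    Units.map (iL A B).toRingHom.toMonoidHom u := by rw [this, div_mul_cancel]
  exact congrArg Units.val h2

section dom
variable [IsDomain A] [IsDomain B] [Algebra.IsIntegral A B] [FaithfulSMul A B]

theorem exists_mul (b : B) (hb : b ≠ 0) : ∃ (a : A) (c : B), a ≠ 0 ∧ b * c = algebraMap A B a := by
  obtain ⟨a, ha, c, hc⟩ := (Algebra.IsAlgebraic.isAlgebraic (R := A) b).exists_nonzero_dvd
    (mem_nonZeroDivisors_of_ne_zero hb)
  exact ⟨a, c, ha, hc.symm⟩

theorem cancelA {T : Type*} [CommRing T] [Algebra A T] [Module.Flat A T] {a : A} (ha : a ≠ 0)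
    {x y : T} (h : algebraMap A T a * x = algebraMap A T a * y) : x = y := by
  have := Module.Flat.isSMulRegular_of_nonZeroDivisors (M := T)
    (mem_nonZeroDivisors_of_ne_zero ha)
  apply this
  simpa [Algebra.smul_def] using h

theorem cancelB {T : Type*} [CommRing T] [Algebra A T] [Module.Flat A T] (f : B →ₐ[A] T) {b : B}
    (hb : b ≠ 0) {x y : T} (h : x * f b = y * f b) : x = y := by
  obtain ⟨a, c, ha, hc⟩ := exists_mul (A := A) b hb
  apply cancelA ha
  rw [← f.commutes, ← hc, map_mul]
  linear_combination (f c) * h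
end dom

variable (A B) in
/-- The submonoid of compatible triples. -/
def Tr [IsDomain A] [IsDomain B] [FaithfulSMul A B] :
    Submonoid ((Ideal A)⁰ × B × (d2 A B).ker) where
  carrier := {t | Ideal.map (algebraMap A B) (t.1 : Ideal A) = Ideal.span {t.2.1} ∧ t.2.1 ≠ 0 ∧
    iL A B t.2.1 = (t.2.2 : (T2 A B)ˣ) * iR A B t.2.1}
  one_mem' := by
    refine ⟨?_, one_ne_zero, ?_⟩
    · simp [Ideal.one_eq_top, Ideal.map_top]
    · simp
  mul_mem' := by
    rintro ⟨I, b, ξ⟩ ⟨I', b', ξ'⟩ ⟨h1, h2, h3⟩ ⟨h1', h2', h3'⟩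
    refine ⟨?_, mul_ne_zero h2 h2', ?_⟩
    · simp only [Prod.mk_mul_mk, Submonoid.coe_mul, Ideal.map_mul] at *
      rw [h1, h1', Ideal.span_singleton_mul_span_singleton]
    · simp only [Prod.mk_mul_mk, map_mul, Subgroup.coe_mul, Units.val_mul] at *
      rw [h3, h3']
      ring

section ded
variable [IsDedekindDomain A] [IsDomain B] [Algebra.IsIntegral A B] [FaithfulSMul A B]

theorem flatB : Module.Flat A B := by
  have : Module.IsTorsionFree A B := inferInstance
  infer_instance

theorem mem_A_of_eq {t : B} (h : iL A B t = iR A B t) : ∃ a, algebraMap A B a = t := by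
  have := flatB (A := A) (B := B)
  have h2 := Algebra.IsEffective.of_faithfullyFlat A B
  have h3 := (h2 t).1 (by
    rw [Algebra.TensorProduct.includeLeftSubRight_apply, sub_eq_zero]
    exact h)
  exact h3

/-- Every principal extension gives a triple. -/
theorem exists_triple (I : (Ideal A)⁰)
    (hI : (Ideal.map (algebraMap A B) (I : Ideal A)).IsPrincipal) :
    ∃ t ∈ Tr A B, t.1 = I := by
  have := flatB (A := A) (B := B)
  obtain ⟨b, hb⟩ := hI
  have hb : Ideal.map (algebraMap A B) (I : Ideal A) = Ideal.span {b} := hb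
  have hb0 : b ≠ 0 := by
    rintro rfl
    rw [Ideal.span_singleton_eq_bot.2 rfl, Ideal.map_eq_bot_iff_of_injective
      (FaithfulSMul.algebraMap_injective A B)] at hb
    exact nonZeroDivisors.coe_ne_zero I hb
  have hL : Ideal.map (algebraMap A (T2 A B)) (I : Ideal A) = Ideal.span {iL A B b} := by
    rw [← (iL A B).comp_algebraMap, ← Ideal.map_map, hb, Ideal.map_span, Set.image_singleton]
    rfl
  have hR : Ideal.map (algebraMap A (T2 A B)) (I : Ideal A) = Ideal.span {iR A B b} := by
    rw [← (iR A B).comp_algebraMap, ← Ideal.map_map, hb, Ideal.map_span, Set.image_singleton]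
    rfl
  have e := hL.symm.trans hR
  obtain ⟨x, hx⟩ := Ideal.mem_span_singleton'.1 (e ▸ Ideal.mem_span_singleton_self (iL A B b))
  obtain ⟨y, hy⟩ := Ideal.mem_span_singleton'.1 (e.symm ▸ Ideal.mem_span_singleton_self (iR A B b))
  have hxy : x * y = 1 := by
    apply cancelB (iL A B) hb0
    linear_combination x * hy + hx
  let ξ : (T2 A B)ˣ := ⟨x, y, hxy, by rw [mul_comm, hxy]⟩
  have hξ : ξ ∈ (d2 A B).ker := by
    rw [mem_ker_d2]
    change q12 A B x * q23 A B x = q13 A B x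
    have e12 := congrArg (q12 A B) hx
    have e13 := congrArg (q13 A B) hx
    have e23 := congrArg (q23 A B) hx
    rw [map_mul, q12_iL, q12_iR] at e12
    rw [map_mul, q13_iL, q13_iR] at e13
    rw [map_mul, q23_iL, q23_iR] at e23
    apply cancelB ((q23 A B).comp (iR A B)) hb0
    rw [AlgHom.comp_apply, q23_iR]
    linear_combination e12 - e13 + q12 A B x * e23
  exact ⟨(I, b, ⟨ξ, hξ⟩), ⟨hb, hb0, hx.symm⟩, rfl⟩

/-- Symmetry gives rationality. -/
theorem rational {b m c : B} {a : A} (ha : a ≠ 0) (hc : b * c = algebraMap A B a)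
    (ξ : T2 A B) (h1 : iL A B b = ξ * iR A B b) (h2 : iL A B m = ξ * iR A B m) :
    ∃ t, algebraMap A B t = m * c := by
  have := flatB (A := A) (B := B)
  apply mem_A_of_eq
  apply cancelA ha
  have eL := congrArg (iL A B) hc
  have eR := congrArg (iR A B) hc
  rw [map_mul, AlgHom.commutes] at eL eR
  rw [map_mul, map_mul]
  nth_rw 1 [← eR]
  rw [← eL]
  linear_combination (iR A B b * iL A B c * iR A B c) * h2 - (iR A B m * iL A B c * iR A B c) * h1

theorem fibres (t t' : (Ideal A)⁰ × B × (d2 A B).ker) (ht : t ∈ Tr A B) (ht' : t' ∈ Tr A B) :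
    ClassGroup.mk0 t.1 = ClassGroup.mk0 t'.1 ↔
      ∃ u, d1 A B u * t'.2.2 = t.2.2 := by
  have := flatB (A := A) (B := B)
  obtain ⟨I, b, ξ, hξ⟩ := t
  obtain ⟨I', b', ξ', hξ'⟩ := t'
  obtain ⟨h1, h2, h3⟩ := ht
  obtain ⟨h1', h2', h3'⟩ := ht'
  dsimp only at *
  rw [ClassGroup.mk0_eq_mk0_iff]
  constructor
  · rintro ⟨x, y, hx, hy, h⟩
    have hh := congrArg (Ideal.map (algebraMap A B)) h
    rw [Ideal.map_mul, Ideal.map_mul, h1, h1', Ideal.map_span, Ideal.map_span, Set.image_singleton,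
      Set.image_singleton, Ideal.span_singleton_mul_span_singleton,
      Ideal.span_singleton_mul_span_singleton, Ideal.span_singleton_eq_span_singleton] at hh
    obtain ⟨u, hu⟩ := hh.symm
    refine ⟨u, ?_⟩
    apply Units.ext
    rw [Units.val_mul]
    have hy' : algebraMap A B y ≠ 0 := by simpa using hy
    apply cancelB (iR A B) (b := u * (algebraMap A B y * b'))
      (mul_ne_zero u.ne_zero (mul_ne_zero hy' h2'))
    have eL := congrArg (iL A B) hu
    have eR := congrArg (iR A B) hu
    have hd := d1_spec (A := A) u
    simp only [map_mul, AlgHom.commutes] at *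
    linear_combination (ξ' * iR A B b' * algebraMap A (T2 A B) y) * hd
      - iL A B u * algebraMap A (T2 A B) y * h3' + eL + algebraMap A (T2 A B) x * h3 - ξ * eR
  · rintro ⟨u, hu⟩
    have hu := congrArg Units.val hu
    rw [Units.val_mul] at hu
    have hd := d1_spec (A := A) u
    have hb'' : (u : B) * b' ≠ 0 := mul_ne_zero u.ne_zero h2'
    obtain ⟨a, c, ha, hc⟩ := exists_mul (A := A) _ hb''
    obtain ⟨t, ht⟩ := rational ha hc ξ (by
      rw [map_mul, map_mul, ← hu, h3', ← hd]; ring) h3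
    have hc0 : c ≠ 0 := by
      rintro rfl
      rw [mul_zero] at hc
      exact ha (by simpa using hc.symm)
    have ht0 : t ≠ 0 := by
      rintro rfl
      rw [map_zero] at ht
      exact mul_ne_zero h2 hc0 ht.symm
    refine ⟨a, t, ha, ht0, ?_⟩
    apply Ideal.map_injective_of_faithfullyFlat (B := B)
    rw [Ideal.map_mul, Ideal.map_mul, h1, h1', Ideal.map_span, Ideal.map_span, Set.image_singleton,
      Set.image_singleton, Ideal.span_singleton_mul_span_singleton,
      Ideal.span_singleton_mul_span_singleton, Ideal.span_singleton_eq_span_singleton]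
    apply Associated.symm
    refine ⟨u, ?_⟩
    rw [← hc, ht]
    ring

/-- Descent. -/
theorem descent (ξ : (T2 A B)ˣ) (hξ : ξ ∈ (d2 A B).ker) :
    ∀ J : Ideal B, (∀ m : B, iL A B m = ξ * iR A B m → m ∈ J) → J = ⊤ := by
  have := flatB (A := A) (B := B)
  intro J hJ
  rw [mem_ker_d2] at hξ
  let f : B →ₗ[A] T2 A B := (iL A B).toLinearMap
  let g : B →ₗ[A] T2 A B := (LinearMap.mulLeft A (ξ : T2 A B)).comp (iR A B).toLinearMap
  have key := Module.Flat.eqLocus_lTensor_eq (S := A) B f g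
  have hf : ∀ x : T2 A B, TensorProduct.AlgebraTensorModule.lTensor A B f x = q12 A B x := by
    intro x
    rfl
  have hg : ∀ x : T2 A B, TensorProduct.AlgebraTensorModule.lTensor A B g x =
      q23 A B ξ * q13 A B x := by
    intro x
    induction x using TensorProduct.induction_on with
    | zero => simp
    | add x y hx hy => rw [map_add, map_add, hx, hy, mul_add]
    | tmul x y => simp [g, q13, q23]
  have hmem : ((ξ⁻¹ : (T2 A B)ˣ) : T2 A B) ∈ LinearMap.eqLocus
      (TensorProduct.AlgebraTensorModule.lTensor A B f)
      (TensorProduct.AlgebraTensorModule.lTensor A B g) := by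
    rw [LinearMap.mem_eqLocus, hf, hg]
    have i12 : q12 A B ξ * q12 A B (ξ⁻¹ : (T2 A B)ˣ) = 1 := by
      rw [← map_mul, Units.mul_inv, map_one]
    have i13 : q13 A B ξ * q13 A B (ξ⁻¹ : (T2 A B)ˣ) = 1 := by
      rw [← map_mul, Units.mul_inv, map_one]
    linear_combination (- q12 A B (ξ⁻¹ : (T2 A B)ˣ)) * i13
      - (q12 A B (ξ⁻¹ : (T2 A B)ˣ) * q13 A B (ξ⁻¹ : (T2 A B)ˣ)) * hξ
      + q23 A B ξ * q13 A B (ξ⁻¹ : (T2 A B)ˣ) * i12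
  rw [key] at hmem
  obtain ⟨z, hz⟩ := hmem
  have hmul : ∀ z, Algebra.TensorProduct.lmul' A (S := B)
      (TensorProduct.AlgebraTensorModule.lTensor A B (LinearMap.eqLocus f g).subtype z) ∈ J := by
    intro z
    induction z using TensorProduct.induction_on with
    | zero => simp
    | add x y hx hy => rw [map_add, map_add]; exact J.add_mem hx hy
    | tmul x y =>
      rw [TensorProduct.AlgebraTensorModule.lTensor_tmul, Algebra.TensorProduct.lmul'_apply_tmul]
      exact J.mul_mem_left _ (hJ _ y.2)
  apply Ideal.eq_top_of_isUnit_mem J (hmul z)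
  rw [hz]
  exact (ξ⁻¹).isUnit.map (Algebra.TensorProduct.lmul' A (S := B))

theorem surj (η : (d2 A B).ker) : ∃ t ∈ Tr A B, t.2.2 = η := by
  have := flatB (A := A) (B := B)
  obtain ⟨ξ, hξ⟩ : ∃ ξ, ξ = η⁻¹ := ⟨_, rfl⟩
  have hd := descent (ξ : (T2 A B)ˣ) ξ.2
  have hη : ((ξ : (T2 A B)ˣ) : T2 A B) * ((η : (T2 A B)ˣ) : T2 A B) = 1 := by
    rw [hξ, ← Units.val_mul, ← Subgroup.coe_mul]
    simp
  obtain ⟨b, hb, hb0⟩ : ∃ b : B, iL A B b = (ξ : (T2 A B)ˣ) * iR A B b ∧ b ≠ 0 := by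
    by_contra! hcon
    exact bot_ne_top (hd ⊥ hcon)
  obtain ⟨a, c, ha, hc⟩ := exists_mul (A := A) b hb0
  have hc0 : c ≠ 0 := by
    rintro rfl
    rw [mul_zero] at hc
    exact ha (by simpa using hc.symm)
  let I : Ideal A :=
    { carrier := {x | ∃ m, iL A B m = (ξ : (T2 A B)ˣ) * iR A B m ∧ algebraMap A B x = c * m}
      zero_mem' := ⟨0, by simp, by simp⟩
      add_mem' := by
        rintro x y ⟨m, hm, hx⟩ ⟨n, hn, hy⟩
        exact ⟨m + n, by rw [map_add, map_add, hm, hn, mul_add], by rw [map_add, hx, hy, mul_add]⟩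
      smul_mem' := by
        rintro r x ⟨m, hm, hx⟩
        refine ⟨algebraMap A B r * m, ?_, ?_⟩
        · rw [map_mul, map_mul, hm, AlgHom.commutes, AlgHom.commutes]; ring
        · rw [smul_eq_mul, map_mul, hx]; ring }
  have hI : I ≠ ⊥ := by
    intro h
    have : a ∈ I := ⟨b, hb, by rw [← hc, mul_comm]⟩
    rw [h] at this
    exact ha this
  have hmap : Ideal.map (algebraMap A B) I = Ideal.span {c} := by
    apply le_antisymm
    · rw [Ideal.map_le_iff_le_comap]
      rintro x ⟨m, hm, hx⟩
      rw [Ideal.mem_comap, Ideal.mem_span_singleton']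
      exact ⟨m, by rw [hx, mul_comm]⟩
    · rw [Ideal.span_singleton_le_iff_mem]
      have h1 := hd ((Ideal.map (algebraMap A B) I).colon {c}) (by
        intro m hm
        rw [Submodule.mem_colon_singleton, smul_eq_mul]
        obtain ⟨t, ht⟩ := rational ha hc _ hb hm
        rw [← ht]
        exact Ideal.mem_map_of_mem _ ⟨m, hm, by rw [ht, mul_comm]⟩)
      have h2 : (1 : B) ∈ (Ideal.map (algebraMap A B) I).colon {c} := by rw [h1]; trivial
      rw [Submodule.mem_colon_singleton, one_smul] at h2
      exact h2
  refine ⟨(⟨I, mem_nonZeroDivisors_of_ne_zero hI⟩, c, η), ⟨hmap, hc0, ?_⟩, rfl⟩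
  dsimp only
  have eL := congrArg (iL A B) hc
  have eR := congrArg (iR A B) hc
  rw [map_mul, AlgHom.commutes] at eL eR
  apply cancelB (iL A B) hb0
  linear_combination eL - eR - (η : (T2 A B)ˣ) * iR A B c * hb - iR A B b * iR A B c * hη

theorem general : ∃ H : Subgroup (ClassGroup A), (H : Set (ClassGroup A)) =
      {c | ∃ I : (Ideal A)⁰, ClassGroup.mk0 I = c ∧
        (Ideal.map (algebraMap A B) (I : Ideal A)).IsPrincipal} ∧
      Nonempty (↥H ≃* (↥(d2 A B).ker ⧸ ((d1 A B).range.subgroupOf (d2 A B).ker))) := by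
  let p3 : Tr A B →* (d2 A B).ker :=
    ((MonoidHom.snd _ _).comp (MonoidHom.snd _ _)).comp (Tr A B).subtype
  let φ : Tr A B →* ClassGroup A := (ClassGroup.mk0.comp (MonoidHom.fst _ _)).comp (Tr A B).subtype
  let ψ : Tr A B →* (↥(d2 A B).ker ⧸ ((d1 A B).range.subgroupOf (d2 A B).ker)) :=
    (QuotientGroup.mk' _).comp p3
  obtain ⟨H, hH, e⟩ := glue φ ψ (by
    intro q
    obtain ⟨η, rfl⟩ := QuotientGroup.mk'_surjective _ q
    obtain ⟨t, ht, rfl⟩ := surj η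
    exact ⟨⟨t, ht⟩, rfl⟩) (by
    rintro ⟨t, ht⟩ ⟨t', ht'⟩
    refine (fibres t t' ht ht').trans ?_
    have : ψ ⟨t, ht⟩ = ψ ⟨t', ht'⟩ ↔ (t'.2.2)⁻¹ * t.2.2 ∈ (d1 A B).range.subgroupOf (d2 A B).ker :=
      eq_comm.trans QuotientGroup.eq
    rw [this, Subgroup.mem_subgroupOf, MonoidHom.mem_range]
    apply exists_congr
    intro u
    rw [Subgroup.coe_mul, Subgroup.coe_inv, eq_inv_mul_iff_mul_eq, mul_comm])
  refine ⟨H, ?_, e⟩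
  rw [hH]
  ext x
  constructor
  · rintro ⟨⟨t, ht⟩, rfl⟩
    exact ⟨t.1, rfl, ⟨_, ht.1⟩⟩
  · rintro ⟨I, rfl, hI⟩
    obtain ⟨t, ht, rfl⟩ := exists_triple I hI
    exact ⟨⟨t, ht⟩, rfl⟩
end ded
end
end CapProof

namespace CapProof

open CapCech NumberField IsDedekindDomain nonZeroDivisors

theorem exists_gen (F : Type*) [Field F] [NumberField F] (v : HeightOneSpectrum (𝓞 F)) :
    ∃ f : 𝓞 F, f ≠ 0 ∧ ∀ w : HeightOneSpectrum (𝓞 F), f ∈ w.asIdeal ↔ w = v := by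
  have hv0 : v.asIdeal ∈ (Ideal (𝓞 F))⁰ := mem_nonZeroDivisors_of_ne_zero v.ne_bot
  have h1 : ClassGroup.mk0 (⟨v.asIdeal, hv0⟩ ^ Fintype.card (ClassGroup (𝓞 F))) = 1 := by
    rw [map_pow, pow_card_eq_one]
  have hcard : Fintype.card (ClassGroup (𝓞 F)) ≠ 0 := Fintype.card_ne_zero
  generalize Fintype.card (ClassGroup (𝓞 F)) = n at *
  have h2 := (ClassGroup.mk0_eq_one_iff (pow_mem hv0 n)).1 h1
  obtain ⟨f, hf⟩ := h2
  have hf : v.asIdeal ^ n = Ideal.span {f} := hf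
  refine ⟨f, ?_, fun w => ?_⟩
  · rintro rfl
    rw [Ideal.span_singleton_eq_bot.2 rfl] at hf
    exact pow_ne_zero n v.ne_bot hf
  · rw [← Ideal.span_singleton_le_iff_mem, ← hf]
    constructor
    · intro h
      have := w.isPrime.le_of_pow_le h
      apply HeightOneSpectrum.ext
      exact (v.isMaximal.eq_of_le w.isPrime.ne_top this).symm
    · rintro rfl
      exact Ideal.pow_le_self hcard

theorem exists_gen_set (F : Type*) [Field F] [NumberField F] (S : Set (HeightOneSpectrum (𝓞 F)))
    (hS : S.Finite) :
    ∃ f : 𝓞 F, f ≠ 0 ∧ ∀ w : HeightOneSpectrum (𝓞 F), f ∈ w.asIdeal ↔ w ∈ S := by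
  choose f hf0 hf using exists_gen F
  refine ⟨∏ v ∈ hS.toFinset, f v, Finset.prod_ne_zero_iff.2 fun v _ => hf0 v, fun w => ?_⟩
  rw [w.isPrime.prod_mem_iff]
  simp [hf]

theorem clear_denominators (F K : Type*) [Field F] [NumberField F] [Field K] [NumberField K]
    [Algebra F K] (S : Set (HeightOneSpectrum (𝓞 F))) (f : 𝓞 F) (hf0 : f ≠ 0)
    (hf : ∀ w : HeightOneSpectrum (𝓞 F), f ∈ w.asIdeal ↔ w ∈ S) (x : K)
    (hx : x ∈ (primesOver F K S).integer K) :
    ∃ (n : ℕ) (y : 𝓞 K), algebraMap F K (f : F) ^ n * x = y := by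
  let J : Ideal (𝓞 K) :=
    { carrier := {c | ∃ y : 𝓞 K, (c : K) * x = y}
      zero_mem' := ⟨0, by simp⟩
      add_mem' := by
        rintro a b ⟨y, hy⟩ ⟨z, hz⟩
        exact ⟨y + z, by push_cast; rw [add_mul, hy, hz]⟩
      smul_mem' := by
        rintro r a ⟨y, hy⟩
        exact ⟨r * y, by rw [smul_eq_mul]; push_cast; rw [mul_assoc, hy]⟩ }
  have hJ : J ≠ ⊥ := by
    obtain ⟨⟨n, d, hd⟩, h⟩ := IsLocalization.surj (nonZeroDivisors (𝓞 K)) x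
    intro hbot
    have : d ∈ J := ⟨n, by rw [mul_comm]; exact h⟩
    rw [hbot] at this
    exact nonZeroDivisors.ne_zero hd this
  have hrad : algebraMap (𝓞 F) (𝓞 K) f ∈ J.radical := by
    rw [Ideal.radical_eq_sInf, Submodule.mem_sInf]
    rintro P ⟨hJP, hP⟩
    let w : HeightOneSpectrum (𝓞 K) := ⟨P, hP, fun h => hJ (le_bot_iff.1 (h ▸ hJP))⟩
    by_cases hw : w ∈ primesOver F K S
    · obtain ⟨v, hv, hvw⟩ := hw
      have : f ∈ v.asIdeal := (hf v).2 hv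
      rw [← hvw] at this
      exact this
    · obtain ⟨n, d, hnd⟩ := w.exists_primeCompl_mul_eq_of_integer x (hx w hw)
      exact absurd (hJP ⟨n, by rw [mul_comm]; exact hnd⟩) d.2
  obtain ⟨n, y, hy⟩ := hrad
  refine ⟨n, y, ?_⟩
  rw [← hy]
  push_cast
  rfl

theorem integralB (F K : Type*) [Field F] [NumberField F] [Field K] [NumberField K]
    [Algebra F K] (S : Set (HeightOneSpectrum (𝓞 F))) (hS : S.Finite)
    [Algebra (OFS F S) (OKS F K S)]
    (hAB : ∀ a : OFS F S, ((algebraMap (OFS F S) (OKS F K S) a : OKS F K S) : K) =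
      algebraMap F K (a : F)) : Algebra.IsIntegral (OFS F S) (OKS F K S) := by
  obtain ⟨f, hf0, hf⟩ := exists_gen_set F S hS
  constructor
  intro x
  obtain ⟨n, y, hy⟩ := clear_denominators F K S f hf0 hf x x.2
  have hf0' : (f : F) ≠ 0 := by simpa using hf0
  let g : OFS F S := ⟨(f : F)⁻¹, fun v hv => by
    have h1 : v.valuation F (f : F) = 1 := by
      apply le_antisymm (v.valuation_le_one f)
      rw [← not_lt]
      intro h
      exact hv ((hf v).1 ((v.valuation_lt_one_iff_mem f).1 h))
    rw [map_inv₀, h1, inv_one]⟩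
  let y' : OKS F K S := algebraMap (𝓞 K) (OKS F K S) y
  have hxy : x = algebraMap (OFS F S) (OKS F K S) g ^ n * y' := by
    apply Subtype.ext
    push_cast
    rw [hAB]
    have : (y' : K) = y := rfl
    rw [this, ← hy]
    have : ((g : OFS F S) : F) = (f : F)⁻¹ := rfl
    rw [this, map_inv₀, ← mul_assoc, ← mul_pow, inv_mul_cancel₀ (by simpa using hf0'), one_pow,
      one_mul]
  rw [hxy]
  apply IsIntegral.mul (isIntegral_algebraMap.pow n)
  have hyZ : IsIntegral ℤ y := RingOfIntegers.isIntegral y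
  have h2 : IsIntegral ℤ y' := hyZ.map (algebraMap (𝓞 K) (OKS F K S)).toIntAlgHom
  exact h2.tower_top

end CapProof

/-- For a finite extension `K/F` of number fields and a finite set `S` of
primes of `F`, the set of ideal classes of `O_{F,S}` capitulating in `K` underlies a subgroup
of the class group, isomorphic to the Čech cohomology group
`Ȟ¹(B/A, 𝔾ₘ) = Ker d₂ / Im d₁` for `A = O_{F,S}`, `B = O_{K,S}`. -/
theorem stmt10 [FiniteDimensional F K] (hS : S.Finite)
    [IsDedekindDomain (OFS F S)] [Algebra (OFS F S) (OKS F K S)]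
    (hAB : ∀ a : OFS F S, ((algebraMap (OFS F S) (OKS F K S) a : OKS F K S) : K) =
      algebraMap F K (a : F)) :
    ∃ H : Subgroup (ClassGroup (OFS F S)), (H : Set (ClassGroup (OFS F S))) = capSet F K S ∧
      Nonempty (↥H ≃*
        (↥(d2 (OFS F S) (OKS F K S)).ker ⧸
          ((d1 (OFS F S) (OKS F K S)).range.subgroupOf (d2 (OFS F S) (OKS F K S)).ker))) := by
  have := CapProof.integralB F K S hS hAB
  have : FaithfulSMul (OFS F S) (OKS F K S) := by
    rw [faithfulSMul_iff_algebraMap_injective]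
    intro a b h
    apply Subtype.ext
    apply (algebraMap F K).injective
    rw [← hAB, ← hAB, h]
  exact CapProof.general
end

section
/- There exist a subgroup Cap of ClassGroup(O_{F,S}) whose underlying set is exactly the set of ideal classes of O_{F,S} that capitulate in K, and group homomorphisms φ₁ : (U_F ∩ U_Kⁿ)/U_Fⁿ → Ȟ¹(B/A, μ_n), φ₂ : Ȟ¹(B/A, μ_n) → Cap, φ₃ : Cap → Ψ/(U_F·U_Kⁿ), φ₄ : Ψ/(U_F·U_Kⁿ) → Ȟ²(B/A, μ_n), such that the sequence 1 → (U_F ∩ U_Kⁿ)/U_Fⁿ → Ȟ¹(B/A, μ_n) → Cap → Ψ/(U_F·U_Kⁿ) → Ȟ²(B/A, μ_n) is exact (φ₁ injective, and the image of each map equals the kernel of the next), every group in the sequence is annihilated by n, and φ₁ sends the class of an element a = uⁿ ∈ U_F ∩ U_Kⁿ (with u ∈ U_K) to the class of (u⊗1)·(1⊗u)⁻¹ ∈ μ_n(B ⊗_A B). -/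
open CapCech

open NumberField IsDedekindDomain
open scoped nonZeroDivisors

variable (F K : Type*) [Field F] [NumberField F] [Field K] [NumberField K] [Algebra F K]
  (S : Set (HeightOneSpectrum (𝓞 F)))

/-- A multiplicative, total relation with trivial value at one is the graph of a hom. -/
theorem relHom {G H : Type*} [Group G] [Group H] (R : G → H → Prop)
    (hmul : ∀ g h g' h', R g h → R g' h' → R (g * g') (h * h'))
    (htot : ∀ g, ∃ h, R g h) (hone : ∀ h, R 1 h → h = 1) :
    ∃ f : G →* H, ∀ g h, R g h ↔ f g = h := by
  have huniq : ∀ g h h', R g h → R g h' → h = h' := by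
    intro g h h' H1 H2
    obtain ⟨k, hk⟩ := htot g⁻¹
    have e1 := hone _ (by simpa using hmul _ _ _ _ H1 hk)
    have e2 := hone _ (by simpa using hmul _ _ _ _ H2 hk)
    exact mul_right_cancel (e1.trans e2.symm)
  choose f hf using htot
  refine ⟨MonoidHom.mk' f fun a b => huniq _ _ _ (hf _) (hmul _ _ _ _ (hf a) (hf b)), ?_⟩
  intro g h
  constructor
  · intro H1; exact huniq _ _ _ (hf g) H1
  · rintro rfl; exact hf g

theorem absSeq {U0 U1 U2 U3 C : Type*} [CommGroup U0] [CommGroup U1] [CommGroup U2]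
    [Group U3] [CommGroup C] (n : ℕ)
    (d1 : U0 →* U1) (d2 : U1 →* U2) (d3 : U2 →* U3)
    (h21 : ∀ x, d2 (d1 x) = 1) (h32 : ∀ x, d3 (d2 x) = 1)
    (UF : Subgroup U0) (hUF : ∀ x, x ∈ UF ↔ d1 x = 1)
    (μ1 : Subgroup U0) (hμ1 : ∀ x, x ∈ μ1 ↔ x ^ n = 1)
    (μ2 : Subgroup U1) (hμ2 : ∀ x, x ∈ μ2 ↔ x ^ n = 1)
    (μ3 : Subgroup U2) (hμ3 : ∀ x, x ∈ μ3 ↔ x ^ n = 1)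
    (δ : d2.ker →* C) (hδ : ∀ x : d2.ker, δ x = 1 ↔ ∃ u, d1 u = x)
    (hδn : ∀ x, δ x ^ n = 1) (cs : Set C) (hcs : ∀ c, c ∈ cs ↔ ∃ x, δ x = c) :
    let UKn := (powMonoidHom n : U0 →* U0).range
    let Ψ := ((powMonoidHom n : U1 →* U1).range).comap d1
    let G1 := ↥(UF ⊓ UKn) ⧸
      ((Subgroup.map (powMonoidHom n) UF).subgroupOf (UF ⊓ UKn))
    let G2 := ↥(μ2 ⊓ d2.ker) ⧸
      ((Subgroup.map d1 μ1).subgroupOf (μ2 ⊓ d2.ker))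
    let G4 := ↥Ψ ⧸ ((UF ⊔ UKn).subgroupOf Ψ)
    let G5 := ↥(μ3 ⊓ d3.ker) ⧸
      ((Subgroup.map d2 μ2).subgroupOf (μ3 ⊓ d3.ker))
    ∃ (Cap : Subgroup C) (φ₁ : G1 →* G2) (φ₂ : G2 →* ↥Cap)
      (φ₃ : ↥Cap →* G4) (φ₄ : G4 →* G5),
      (Cap : Set C) = cs ∧
      Function.Injective φ₁ ∧
      φ₁.range = φ₂.ker ∧ φ₂.range = φ₃.ker ∧ φ₃.range = φ₄.ker ∧
      (∀ x : G1, x ^ n = 1) ∧ (∀ x : G2, x ^ n = 1) ∧ (∀ x : ↥Cap, x ^ n = 1) ∧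
      (∀ x : G4, x ^ n = 1) ∧ (∀ x : G5, x ^ n = 1) ∧
      (∀ (u : U0) (x : ↥(UF ⊓ UKn)), (x : U0) = u ^ n →
        ∀ z : ↥(μ2 ⊓ d2.ker), (z : U1) = d1 u →
          φ₁ (QuotientGroup.mk x) = QuotientGroup.mk z) := by
  intro UKn Ψ G1 G2 G4 G5
  let Cap : Subgroup C := δ.range
  have one1 : ∀ x : ↥(UF ⊓ UKn), (QuotientGroup.mk x : G1) = 1 ↔ ∃ a, d1 a = 1 ∧ a ^ n = x := by
    intro x
    rw [QuotientGroup.eq_one_iff, Subgroup.mem_subgroupOf, Subgroup.mem_map]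
    simp [hUF]
  have one2 : ∀ x : ↥(μ2 ⊓ d2.ker), (QuotientGroup.mk x : G2) = 1 ↔
      ∃ a, a ^ n = 1 ∧ d1 a = x := by
    intro x
    rw [QuotientGroup.eq_one_iff, Subgroup.mem_subgroupOf, Subgroup.mem_map]
    simp [hμ1]
  have one4 : ∀ x : ↥Ψ, (QuotientGroup.mk x : G4) = 1 ↔
      ∃ a v, d1 a = 1 ∧ a * v ^ n = x := by
    intro x
    rw [QuotientGroup.eq_one_iff, Subgroup.mem_subgroupOf, Subgroup.mem_sup]
    simp [hUF, UKn]
  have one5 : ∀ x : ↥(μ3 ⊓ d3.ker), (QuotientGroup.mk x : G5) = 1 ↔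
      ∃ a, a ^ n = 1 ∧ d2 a = x := by
    intro x
    rw [QuotientGroup.eq_one_iff, Subgroup.mem_subgroupOf, Subgroup.mem_map]
    simp [hμ2]
  -- φ₁
  obtain ⟨φ₁, hφ₁⟩ := relHom (G := G1) (H := G2)
    (fun g h => ∃ (u : U0) (x : ↥(UF ⊓ UKn)) (z : ↥(μ2 ⊓ d2.ker)),
      (x : U0) = u ^ n ∧ (z : U1) = d1 u ∧ QuotientGroup.mk x = g ∧ QuotientGroup.mk z = h)
    (by
      rintro g h g' h' ⟨u, x, z, hx, hz, rfl, rfl⟩ ⟨u', x', z', hx', hz', rfl, rfl⟩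
      exact ⟨u * u', x * x', z * z', by simp [hx, hx', mul_pow], by simp [hz, hz'], rfl, rfl⟩)
    (by
      intro g
      obtain ⟨x, rfl⟩ := QuotientGroup.mk_surjective g
      obtain ⟨u, hu⟩ := x.2.2
      have hu' : u ^ n = x := hu
      have hx := (hUF _).1 x.2.1
      refine ⟨_, u, x, ⟨d1 u, ?_, ?_⟩, hu'.symm, rfl, rfl, rfl⟩
      · refine (hμ2 _).2 ?_
        rw [← map_pow, hu', hx]
      · exact h21 u)
    (by
      rintro h ⟨u, x, z, hx, hz, h1, rfl⟩
      rw [one1] at h1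
      obtain ⟨a, ha, hax⟩ := h1
      rw [one2]
      refine ⟨u * a⁻¹, ?_, ?_⟩
      · rw [mul_pow, inv_pow, hax, hx, mul_inv_cancel]
      · rw [map_mul, map_inv, ha, inv_one, mul_one, hz])
  -- φ₂
  obtain ⟨φ₂, hφ₂⟩ := relHom (G := G2) (H := Cap)
    (fun g h => ∃ (z : ↥(μ2 ⊓ d2.ker)), QuotientGroup.mk z = g ∧ δ ⟨z, z.2.2⟩ = (h : C))
    (by
      rintro g h g' h' ⟨z, rfl, hz⟩ ⟨z', rfl, hz'⟩
      refine ⟨z * z', rfl, ?_⟩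
      exact (map_mul δ ⟨z, z.2.2⟩ ⟨z', z'.2.2⟩).trans (congrArg₂ _ hz hz'))
    (by
      intro g
      obtain ⟨x, rfl⟩ := QuotientGroup.mk_surjective g
      exact ⟨⟨_, _, rfl⟩, x, rfl, rfl⟩)
    (by
      rintro h ⟨z, h1, hz⟩
      rw [one2] at h1
      obtain ⟨a, ha, haz⟩ := h1
      ext
      rw [← hz, Subgroup.coe_one, hδ]
      exact ⟨a, haz⟩)
  -- φ₃
  obtain ⟨φ₃, hφ₃⟩ := relHom (G := Cap) (H := G4)
    (fun g h => ∃ (ξ : d2.ker) (u : Ψ), δ ξ = (g : C) ∧ (ξ : U1) ^ n = d1 u ∧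
      QuotientGroup.mk u = h)
    (by
      rintro g h g' h' ⟨ξ, u, h1, h2, rfl⟩ ⟨ξ', u', h1', h2', rfl⟩
      exact ⟨ξ * ξ', u * u', by simp [h1, h1'], by simp [mul_pow, h2, h2'], rfl⟩)
    (by
      rintro ⟨g, ξ, rfl⟩
      obtain ⟨u, hu⟩ := (hδ (ξ ^ n)).1 (by rw [map_pow, hδn])
      exact ⟨_, ξ, ⟨u, ξ, hu.symm⟩, rfl, hu.symm, rfl⟩)
    (by
      rintro h ⟨ξ, u, h1, h2, rfl⟩
      obtain ⟨v, hv⟩ := (hδ ξ).1 h1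
      rw [one4]
      refine ⟨u * (v ^ n)⁻¹, v, ?_, by simp⟩
      rw [map_mul, map_inv, map_pow, hv, h2, mul_inv_cancel])
  -- φ₄
  obtain ⟨φ₄, hφ₄⟩ := relHom (G := G4) (H := G5)
    (fun g h => ∃ (u : Ψ) (η : U1) (z : ↥(μ3 ⊓ d3.ker)), d1 u = η ^ n ∧ (z : U2) = d2 η ∧
      QuotientGroup.mk u = g ∧ QuotientGroup.mk z = h)
    (by
      rintro g h g' h' ⟨u, η, z, h1, h2, rfl, rfl⟩ ⟨u', η', z', h1', h2', rfl, rfl⟩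
      exact ⟨u * u', η * η', z * z', by simp [h1, h1', mul_pow], by simp [h2, h2'], rfl, rfl⟩)
    (by
      intro g
      obtain ⟨u, rfl⟩ := QuotientGroup.mk_surjective g
      obtain ⟨η, hη⟩ := u.2
      have hη' : η ^ n = d1 u := hη
      refine ⟨_, u, η, ⟨d2 η, ?_, h32 η⟩, hη'.symm, rfl, rfl, rfl⟩
      refine (hμ3 _).2 ?_
      rw [← map_pow, hη', h21])
    (by
      rintro h ⟨u, η, z, h1, h2, h3, rfl⟩
      rw [one4] at h3
      obtain ⟨a, v, ha, hav⟩ := h3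
      rw [one5]
      refine ⟨η * (d1 v)⁻¹, ?_, ?_⟩
      · rw [mul_pow, ← h1, ← hav, map_mul, ha, one_mul, inv_pow, map_pow, mul_inv_cancel]
      · rw [map_mul, map_inv, h21, inv_one, mul_one, h2])
  refine ⟨Cap, φ₁, φ₂, φ₃, φ₄, ?_, ?_, ?_, ?_, ?_, ?_, ?_, ?_, ?_, ?_, ?_⟩
  · ext c
    exact (hcs c).symm
  · rw [injective_iff_map_eq_one]
    intro g hg
    rw [← hφ₁] at hg
    obtain ⟨u, x, z, h1, h2, rfl, h3⟩ := hg
    rw [one2] at h3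
    obtain ⟨a, ha, haz⟩ := h3
    rw [one1]
    refine ⟨u * a⁻¹, ?_, ?_⟩
    · rw [map_mul, map_inv, haz, h2, mul_inv_cancel]
    · rw [mul_pow, inv_pow, ha, inv_one, mul_one, h1]
  · ext g
    rw [MonoidHom.mem_ker, MonoidHom.mem_range, ← hφ₂]
    constructor
    · rintro ⟨y, hy⟩
      rw [← hφ₁] at hy
      obtain ⟨u, x, z, h1, h2, rfl, rfl⟩ := hy
      exact ⟨z, rfl, (hδ _).2 ⟨u, h2.symm⟩⟩
    · rintro ⟨z, rfl, hz⟩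
      obtain ⟨u, hu⟩ := (hδ _).1 hz
      have hu' : d1 u = z := hu
      refine ⟨QuotientGroup.mk ⟨u ^ n, ?_, u, rfl⟩, (hφ₁ _ _).1 ⟨u, _, z, rfl, hu'.symm, rfl, rfl⟩⟩
      refine (hUF _).2 ?_
      rw [map_pow, hu']
      exact (hμ2 _).1 z.2.1
  · ext g
    rw [MonoidHom.mem_ker, MonoidHom.mem_range, ← hφ₃]
    constructor
    · rintro ⟨y, hy⟩
      rw [← hφ₂] at hy
      obtain ⟨z, rfl, h1⟩ := hy
      refine ⟨⟨z, z.2.2⟩, 1, h1, ?_, rfl⟩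
      simpa using (hμ2 _).1 z.2.1
    · rintro ⟨ξ, u, h1, h2, h3⟩
      rw [one4] at h3
      obtain ⟨a, v, ha, hav⟩ := h3
      refine ⟨QuotientGroup.mk ⟨ξ * (d1 v)⁻¹, ?_, ?_⟩, (hφ₂ _ _).1 ⟨_, rfl, ?_⟩⟩
      · refine (hμ2 _).2 ?_
        rw [mul_pow, h2, ← hav, map_mul, ha, one_mul, map_pow, inv_pow, mul_inv_cancel]
      · show d2 _ = 1
        rw [map_mul, map_inv, h21, inv_one, mul_one]
        exact ξ.2
      · have e : δ ⟨(d1 v)⁻¹, by show d2 _ = 1; rw [map_inv, h21, inv_one]⟩ = 1 :=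
          (hδ _).2 ⟨v⁻¹, by simp⟩
        exact (map_mul δ ξ ⟨(d1 v)⁻¹, _⟩).trans (by rw [e, mul_one, h1])
  · ext g
    rw [MonoidHom.mem_ker, MonoidHom.mem_range, ← hφ₄]
    constructor
    · rintro ⟨y, hy⟩
      rw [← hφ₃] at hy
      obtain ⟨ξ, u, h1, h2, rfl⟩ := hy
      exact ⟨u, ξ, 1, h2.symm, ξ.2.symm, rfl, rfl⟩
    · rintro ⟨u, η, z, h1, h2, rfl, h3⟩
      rw [one5] at h3
      obtain ⟨a, ha, haz⟩ := h3
      have hk : η * a⁻¹ ∈ d2.ker := by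
        show d2 _ = 1
        rw [map_mul, map_inv, haz, h2, mul_inv_cancel]
      refine ⟨⟨δ ⟨η * a⁻¹, hk⟩, _, rfl⟩, (hφ₃ _ _).1 ⟨⟨η * a⁻¹, hk⟩, u, rfl, ?_, rfl⟩⟩
      show (η * a⁻¹) ^ n = _
      rw [mul_pow, inv_pow, ha, inv_one, mul_one, h1]
  · intro g
    obtain ⟨x, rfl⟩ := QuotientGroup.mk_surjective g
    exact (one1 (x ^ n)).2 ⟨x, (hUF _).1 x.2.1, rfl⟩
  · intro g
    obtain ⟨x, rfl⟩ := QuotientGroup.mk_surjective g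
    exact (one2 (x ^ n)).2 ⟨1, by simp, by simpa using ((hμ2 _).1 x.2.1).symm⟩
  · rintro ⟨c, ξ, rfl⟩
    ext
    exact hδn ξ
  · intro g
    obtain ⟨x, rfl⟩ := QuotientGroup.mk_surjective g
    exact (one4 (x ^ n)).2 ⟨1, x, by simp, by simp⟩
  · intro g
    obtain ⟨x, rfl⟩ := QuotientGroup.mk_surjective g
    exact (one5 (x ^ n)).2 ⟨1, by simp, by simpa using ((hμ3 _).1 x.2.1).symm⟩
  · intro u x hx z hz
    exact (hφ₁ _ _).1 ⟨u, x, z, hx, hz, rfl, rfl⟩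


section CapRing

set_option linter.unusedSectionVars false
set_option linter.unusedSimpArgs false
set_option linter.overlappingInstances false

open TensorProduct

variable {A B : Type*} [CommRing A] [CommRing B] [Algebra A B]

theorem cap_comm_group6 {G : Type*} [CommGroup G] (a b c d e f : G) :
    (a * b⁻¹ * c) * (a * d⁻¹ * e)⁻¹ * ((b * d⁻¹ * f) * (c * e⁻¹ * f)⁻¹) = 1 := by
  have key : ∀ {H : Type _} [AddCommGroup H] (a b c d e f : H),
    (a + -b + c) + -(a + -d + e) + ((b + -d + f) + -(c + -e + f)) = 0 := by
    intro H _ a b c d e f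
    abel
  exact key (H := Additive G) a b c d e f

theorem cap_d1_val (u : Bˣ) : ((d1 A B u : (T2 A B)ˣ) : T2 A B) = (u : B) ⊗ₜ[A] (↑u⁻¹ : B) := by
  simp [d1, div_eq_mul_inv, ← map_inv]

theorem cap_d1_eq_iff (u : Bˣ) (ξ : (T2 A B)ˣ) :
    d1 A B u = ξ ↔ ((u : B) ⊗ₜ[A] (1 : B) : T2 A B) = ξ * ((1 : B) ⊗ₜ[A] (u : B)) := by
  unfold d1
  rw [MonoidHom.div_apply, div_eq_iff_eq_mul, Units.ext_iff]
  rfl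

theorem cap_d2_eq_one_iff (ξ : (T2 A B)ˣ) :
    d2 A B ξ = 1 ↔ q12 A B ξ * q23 A B ξ = q13 A B ξ := by
  have : d2 A B ξ = Units.map (q23 A B).toRingHom.toMonoidHom ξ *
      (Units.map (q13 A B).toRingHom.toMonoidHom ξ)⁻¹ *
    Units.map (q12 A B).toRingHom.toMonoidHom ξ := rfl
  have key : ∀ {G : Type _} [CommGroup G] (a b c : G), a * b⁻¹ * c = 1 ↔ c * a = b := by
    intro G _ a b c
    rw [mul_right_comm, mul_inv_eq_one, mul_comm]
  refine Iff.trans (key (G := (T3 A B)ˣ) _ _ _) ?_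
  rw [Units.ext_iff]
  rfl

theorem cap_d2_d1 (u : Bˣ) : d2 A B (d1 A B u) = 1 := by
  rw [cap_d2_eq_one_iff, cap_d1_val]
  simp [q12, q13, q23, Algebra.TensorProduct.one_def]

set_option synthInstance.maxHeartbeats 400000 in
set_option maxHeartbeats 1000000 in
theorem cap_d3_d2 (ξ : (T2 A B)ˣ) : d3 A B (d2 A B ξ) = 1 := by
  have e1 : (r2 A B).comp (q23 A B) = (r1 A B).comp (q23 A B) := by
    ext <;> simp [r1, r2, q23, Algebra.TensorProduct.one_def]
  have e2 : (r3 A B).comp (q23 A B) = (r1 A B).comp (q13 A B) := by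
    ext <;> simp [r1, r3, q23, q13, Algebra.TensorProduct.one_def]
  have e3 : (r3 A B).comp (q13 A B) = (r2 A B).comp (q13 A B) := by
    ext <;> simp [r2, r3, q13, Algebra.TensorProduct.one_def]
  have e4 : (r4 A B).comp (q23 A B) = (r1 A B).comp (q12 A B) := by
    ext <;> simp [r1, r4, q23, q12, Algebra.TensorProduct.one_def]
  have e5 : (r4 A B).comp (q13 A B) = (r2 A B).comp (q12 A B) := by
    ext <;> simp [r2, r4, q13, q12, Algebra.TensorProduct.one_def]
  have e6 : (r4 A B).comp (q12 A B) = (r3 A B).comp (q12 A B) := by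
    ext <;> simp [r3, r4, q12, Algebra.TensorProduct.one_def]
  have U : ∀ {f g : T3 A B →ₐ[A] T4 A B} {h k : T2 A B →ₐ[A] T3 A B}, f.comp h = g.comp k →
      Units.map f.toRingHom.toMonoidHom (Units.map h.toRingHom.toMonoidHom ξ) =
      Units.map g.toRingHom.toMonoidHom (Units.map k.toRingHom.toMonoidHom ξ) := by
    intro f g h k H
    ext
    exact DFunLike.congr_fun H (ξ : T2 A B)
  have h2 : d2 A B ξ = Units.map (q23 A B).toRingHom.toMonoidHom ξ *
      (Units.map (q13 A B).toRingHom.toMonoidHom ξ)⁻¹ *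
    Units.map (q12 A B).toRingHom.toMonoidHom ξ := rfl
  have h3 : ∀ ξ, d3 A B ξ = Units.map (r1 A B).toRingHom.toMonoidHom ξ *
      (Units.map (r2 A B).toRingHom.toMonoidHom ξ)⁻¹ *
    (Units.map (r3 A B).toRingHom.toMonoidHom ξ *
      (Units.map (r4 A B).toRingHom.toMonoidHom ξ)⁻¹) := fun _ => rfl
  rw [h3, h2]
  simp only [map_mul, map_inv]
  rw [U e1, U e2, U e3, U e4, U e5, U e6]
  letI : CommRing (T4 A B) := Algebra.TensorProduct.instCommRing
  letI : CommGroup (T4 A B)ˣ := Units.instCommGroupUnits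
  exact cap_comm_group6 (G := (T4 A B)ˣ) _ _ _ _ _ _

theorem cap_regR {C : Type*} [CommRing C] [Algebra A C] [Module.Flat A B] (c : C)
    (hc : ∀ x y, c * x = c * y → x = y) (x y : B ⊗[A] C)
    (h : ((1 : B) ⊗ₜ[A] c) * x = ((1 : B) ⊗ₜ[A] c) * y) : x = y := by
  have hi := Module.Flat.lTensor_preserves_injective_linearMap (M := B) (LinearMap.mulLeft A c)
    (fun x y h => hc x y h)
  have e : ∀ z : B ⊗[A] C, (LinearMap.mulLeft A c).lTensor B z = ((1 : B) ⊗ₜ[A] c) * z := by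
    intro z
    induction z using TensorProduct.induction_on with
    | zero => simp
    | add x y hx hy => rw [map_add, hx, hy, mul_add]
    | tmul x y => simp
  exact hi (by rw [e, e, h])

theorem cap_regL {C : Type*} [CommRing C] [Algebra A C] [Module.Flat A C] (b : B)
    (hb : ∀ x y, b * x = b * y → x = y) (x y : B ⊗[A] C)
    (h : (b ⊗ₜ[A] (1 : C)) * x = (b ⊗ₜ[A] (1 : C)) * y) : x = y := by
  have hi := Module.Flat.rTensor_preserves_injective_linearMap (M := C) (LinearMap.mulLeft A b)
    (fun x y h => hb x y h)
  have e : ∀ z : B ⊗[A] C, (LinearMap.mulLeft A b).rTensor C z = (b ⊗ₜ[A] (1 : C)) * z := by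
    intro z
    induction z using TensorProduct.induction_on with
    | zero => simp
    | add x y hx hy => rw [map_add, hx, hy, mul_add]
    | tmul x y => simp
  exact hi (by rw [e, e, h])

theorem cap_swap (x y : B) (h : x ⊗ₜ[A] y = y ⊗ₜ[A] x) (φ : B →ₗ[A] A) :
    φ x • y = φ y • x := by
  have := congrArg (fun z => TensorProduct.lid A B (φ.rTensor B z)) h
  simpa using this

theorem cap_dual_basis [Module.Finite A B] [Module.Projective A B] :
    ∃ (k : ℕ) (e : Fin k → B) (l : Fin k → (B →ₗ[A] A)), ∀ x, ∑ j, l j x • e j = x := by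
  obtain ⟨k, f, g, -, -, hfg⟩ := Module.Finite.exists_comp_eq_id_of_projective A B
  refine ⟨k, fun j => f (Pi.single j 1), fun j => (LinearMap.proj j).comp g, fun x => ?_⟩
  have := DFunLike.congr_fun hfg x
  simp only [LinearMap.comp_apply, LinearMap.id_apply] at this
  conv_rhs => rw [← this, ← Finset.univ_sum_single (g x), map_sum]
  refine Finset.sum_congr rfl fun j _ => ?_
  rw [← map_smul, ← Pi.single_smul]
  simp

theorem cap_exists_dual_ne [Module.Finite A B] [Module.Projective A B] (x : B) (hx : x ≠ 0) :
    ∃ φ : B →ₗ[A] A, φ x ≠ 0 := by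
  obtain ⟨k, e, l, h⟩ := cap_dual_basis (A := A) (B := B)
  by_contra! H
  exact hx (by rw [← h x]; simp [H])

/-- Contraction of the first tensor factor along a linear form. -/
noncomputable def capContr (C : Type*) [CommRing C] [Algebra A C] (l : B →ₗ[A] A) :
    B ⊗[A] C →ₗ[A] C :=
  (TensorProduct.lid A C).toLinearMap ∘ₗ l.rTensor C

theorem capContr_tmul {C : Type*} [CommRing C] [Algebra A C] (l : B →ₗ[A] A) (x : B) (y : C) :
    capContr C l (x ⊗ₜ y) = l x • y := by
  simp [capContr]

theorem cap_contr_cocycle (l : B →ₗ[A] A) (ξ : (T2 A B)ˣ) (h : d2 A B ξ = 1) :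
    (1 : B) ⊗ₜ[A] (capContr B l (ξ : T2 A B)) = (capContr B l (ξ : T2 A B) ⊗ₜ[A] (1 : B)) * ξ := by
  rw [cap_d2_eq_one_iff] at h
  have e12 : ∀ z : T2 A B, capContr (T2 A B) l (q12 A B z) = capContr B l z ⊗ₜ[A] (1 : B) := by
    intro z
    induction z using TensorProduct.induction_on with
    | zero => simp
    | add x y hx hy => rw [map_add, map_add, hx, hy, map_add, TensorProduct.add_tmul]
    | tmul x y => simp [q12, capContr_tmul, TensorProduct.smul_tmul']
  have e13 : ∀ z : T2 A B, capContr (T2 A B) l (q13 A B z) = (1 : B) ⊗ₜ[A] capContr B l z := by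
    intro z
    induction z using TensorProduct.induction_on with
    | zero => simp
    | add x y hx hy => rw [map_add, map_add, hx, hy, map_add, TensorProduct.tmul_add]
    | tmul x y => simp [q13, capContr_tmul]
  have e23 : ∀ (z : T3 A B) (ξ : T2 A B), capContr (T2 A B) l (z * q23 A B ξ) =
      capContr (T2 A B) l z * ξ := by
    intro z ξ
    induction z using TensorProduct.induction_on with
    | zero => simp
    | add x y hx hy => rw [add_mul, map_add, map_add, hx, hy, add_mul]
    | tmul x y => simp [q23, capContr_tmul]
  rw [← e13, ← h, e23, e12]

/-- The relation between cocycles and ideal classes. -/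
def CapRel (A B : Type*) [CommRing A] [IsDedekindDomain A] [CommRing B]
    [Algebra A B] (ξ : (T2 A B)ˣ) (c : ClassGroup A) : Prop :=
  ∃ (I : (Ideal A)⁰) (b : B), b ≠ 0 ∧ (I : Ideal A).map (algebraMap A B) = Ideal.span {b} ∧
    (b ⊗ₜ[A] (1 : B) : T2 A B) = ξ * ((1 : B) ⊗ₜ[A] b) ∧ ClassGroup.mk0 I = c

variable [IsDedekindDomain A] [IsDomain B] [Module.Finite A B] [Module.Projective A B]
  [FaithfulSMul A B]


theorem cap_canc {b : B} (hb : b ≠ 0) : ∀ x y, b * x = b * y → x = y :=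
  fun _ _ h => mul_left_cancel₀ hb h

theorem cap_ff : Module.FaithfullyFlat A B := inferInstance

theorem capRel_mul (ξ ξ' : (T2 A B)ˣ) (c c' : ClassGroup A) (h : CapRel A B ξ c)
    (h' : CapRel A B ξ' c') : CapRel A B (ξ * ξ') (c * c') := by
  obtain ⟨I, b, hb, hI, hξ, rfl⟩ := h
  obtain ⟨I', b', hb', hI', hξ', rfl⟩ := h'
  refine ⟨I * I', b * b', mul_ne_zero hb hb', ?_, ?_, map_mul _ _ _⟩
  · rw [Submonoid.coe_mul, Ideal.map_mul, hI, hI', Ideal.span_singleton_mul_span_singleton]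
  · have e1 : ((b * b') ⊗ₜ[A] (1 : B) : T2 A B) = (b ⊗ₜ 1) * (b' ⊗ₜ 1) := by simp
    have e2 : ((1 : B) ⊗ₜ[A] (b * b') : T2 A B) = (1 ⊗ₜ b) * (1 ⊗ₜ b') := by simp
    rw [e1, e2, hξ, hξ', Units.val_mul]
    ring

theorem cap_frac (b : B) (h : (b ⊗ₜ[A] (1 : B) : T2 A B) = (1 : B) ⊗ₜ[A] b) :
    ∃ s t : A, s ≠ 0 ∧ algebraMap A B s * b = algebraMap A B t := by
  obtain ⟨φ, hφ⟩ := cap_exists_dual_ne (A := A) (1 : B) one_ne_zero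
  refine ⟨φ 1, φ b, hφ, ?_⟩
  have := cap_swap _ _ h φ
  rw [← Algebra.smul_def, ← this, Algebra.smul_def, mul_one]

theorem capRel_one (c : ClassGroup A) (h : CapRel A B 1 c) : c = 1 := by
  obtain ⟨I, b, hb, hI, hξ, rfl⟩ := h
  rw [Units.val_one, one_mul] at hξ
  obtain ⟨s, t, hs, hst⟩ := cap_frac b hξ
  have ht : t ≠ 0 := by
    rintro rfl
    rw [map_zero, mul_eq_zero] at hst
    rcases hst with h | h
    · exact hs ((FaithfulSMul.algebraMap_eq_zero_iff A B).1 h)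
    · exact hb h
  have ff := cap_ff (A := A) (B := B)
  rw [← map_one (ClassGroup.mk0 (R := A)), ClassGroup.mk0_eq_mk0_iff]
  refine ⟨s, t, hs, ht, ?_⟩
  rw [Submonoid.coe_one, mul_one]
  have := congrArg (Ideal.comap (algebraMap A B)) (show Ideal.map (algebraMap A B)
    (Ideal.span {s} * (I : Ideal A)) = Ideal.map (algebraMap A B) (Ideal.span {t}) by
      rw [Ideal.map_mul, hI, Ideal.map_span, Ideal.map_span, Set.image_singleton,
        Set.image_singleton, Ideal.span_singleton_mul_span_singleton, hst])
  rwa [Ideal.comap_map_eq_self_of_faithfullyFlat, Ideal.comap_map_eq_self_of_faithfullyFlat] at this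

theorem cap_d1_ker (u : Bˣ) :
    u ∈ (Units.map (algebraMap A B).toMonoidHom).range ↔ d1 A B u = 1 := by
  have ff := cap_ff (A := A) (B := B)
  constructor
  · rintro ⟨a, rfl⟩
    rw [cap_d1_eq_iff, Units.val_one, one_mul]
    show algebraMap A B a ⊗ₜ[A] (1 : B) = 1 ⊗ₜ[A] algebraMap A B a
    rw [Algebra.algebraMap_eq_smul_one, TensorProduct.smul_tmul]
  · intro h
    rw [cap_d1_eq_iff, Units.val_one, one_mul] at h
    obtain ⟨s, t, hs, hst⟩ := cap_frac (u : B) h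
    have h1 : t ∈ Ideal.comap (algebraMap A B) (Ideal.map (algebraMap A B) (Ideal.span {s})) := by
      rw [Ideal.mem_comap, ← hst]
      exact Ideal.mul_mem_right _ _ (Ideal.mem_map_of_mem _ (Ideal.mem_span_singleton_self s))
    rw [Ideal.comap_map_eq_self_of_faithfullyFlat, Ideal.mem_span_singleton] at h1
    obtain ⟨r, rfl⟩ := h1
    have hs' : algebraMap A B s ≠ 0 := fun h => hs ((FaithfulSMul.algebraMap_eq_zero_iff A B).1 h)
    rw [map_mul] at hst
    have hu : (u : B) = algebraMap A B r := mul_left_cancel₀ hs' hst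
    have hr : IsUnit r := by
      refine isUnit_of_map_unit (algebraMap A B) r ?_
      rw [← hu]
      exact u.isUnit
    obtain ⟨r, rfl⟩ := hr
    exact ⟨r, Units.ext hu.symm⟩

theorem capRel_total (ξ : (T2 A B)ˣ) (h : d2 A B ξ = 1) : ∃ c, CapRel A B ξ c := by
  obtain ⟨k, e, l, he⟩ := cap_dual_basis (A := A) (B := B)
  let m : Fin k → B := fun j => capContr B (l j) (ξ : T2 A B)
  have hm : ∀ j, (1 : B) ⊗ₜ[A] m j = (m j ⊗ₜ[A] (1 : B)) * ξ := fun j =>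
    cap_contr_cocycle (l j) ξ h
  have hw : ∀ z : T2 A B, Algebra.TensorProduct.lmul' A z = ∑ j, e j * capContr B (l j) z := by
    intro z
    induction z using TensorProduct.induction_on with
    | zero => simp
    | add x y hx hy => simp only [map_add, hx, hy, mul_add, Finset.sum_add_distrib]
    | tmul x y =>
      simp only [capContr_tmul, Algebra.TensorProduct.lmul'_apply_tmul]
      conv_lhs => rw [← he x, Finset.sum_mul]
      simp
  let w : Bˣ := Units.map (Algebra.TensorProduct.lmul' A (S := B)).toRingHom.toMonoidHom ξ
  have hw' : (w : B) = ∑ j, e j * m j := hw ξ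
  obtain ⟨j0, hj0⟩ : ∃ j, m j ≠ 0 := by
    by_contra! H
    exact w.ne_zero (by rw [hw']; simp [H])
  set b0 := m j0 with hb0
  obtain ⟨φ, hφ⟩ := cap_exists_dual_ne (A := A) b0 hj0
  have hp : ∀ j, algebraMap A B (φ b0) * m j = algebraMap A B (φ (m j)) * b0 := by
    intro j
    have : b0 ⊗ₜ[A] m j = m j ⊗ₜ[A] b0 := by
      have e1 : b0 ⊗ₜ[A] m j = (b0 ⊗ₜ[A] (1 : B)) * ((1 : B) ⊗ₜ[A] m j) := by simp
      have e2 : m j ⊗ₜ[A] b0 = (m j ⊗ₜ[A] (1 : B)) * ((1 : B) ⊗ₜ[A] b0) := by simp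
      rw [e1, e2, hm, hm]
      ring
    have := cap_swap _ _ this φ
    rwa [Algebra.smul_def, Algebra.smul_def] at this
  let q := φ b0
  let I : Ideal A := Ideal.span (Set.range fun j => φ (m j))
  let c : B := (↑w⁻¹ : B) * ∑ j, e j * algebraMap A B (φ (m j))
  have hcb : c * b0 = algebraMap A B q := by
    have : (w : B) * (c * b0) = w * algebraMap A B q := by
      simp only [c]
      rw [mul_assoc, Units.mul_inv_cancel_left, Finset.sum_mul, hw', Finset.sum_mul]
      refine Finset.sum_congr rfl fun j _ => ?_
      rw [mul_assoc, ← hp j]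
      ring
    exact mul_left_cancel₀ w.ne_zero this
  have hq : algebraMap A B q ≠ 0 := fun h => hφ ((FaithfulSMul.algebraMap_eq_zero_iff A B).1 h)
  have hc0 : c ≠ 0 := by
    rintro h0
    rw [h0, zero_mul] at hcb
    exact hq hcb.symm
  have hmap : I.map (algebraMap A B) = Ideal.span {c} := by
    apply le_antisymm
    · rw [Ideal.map_span, Ideal.span_le]
      rintro _ ⟨_, ⟨j, rfl⟩, rfl⟩
      refine Ideal.mem_span_singleton.2 ⟨m j, ?_⟩
      apply mul_right_cancel₀ hj0
      show algebraMap A B (φ (m j)) * b0 = c * m j * b0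
      rw [← hp j, mul_right_comm, hcb]
    · rw [Ideal.span_le, Set.singleton_subset_iff]
      refine Ideal.mul_mem_left _ _ (Ideal.sum_mem _ fun j _ => Ideal.mul_mem_left _ _ ?_)
      exact Ideal.mem_map_of_mem _ (Ideal.subset_span ⟨j, rfl⟩)
  have hI : I ∈ (Ideal A)⁰ := by
    rw [mem_nonZeroDivisors_iff_ne_zero]
    rintro h0
    rw [h0, Ideal.zero_eq_bot, Ideal.map_bot, eq_comm, Ideal.span_singleton_eq_bot] at hmap
    exact hc0 hmap
  refine ⟨_, ⟨I, hI⟩, c, hc0, hmap, ?_, rfl⟩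
  apply cap_regL b0 (cap_canc hj0)
  have e1 : (b0 ⊗ₜ[A] (1 : B)) * (c ⊗ₜ[A] (1 : B)) = ((1 : B) ⊗ₜ[A] b0) * ((1 : B) ⊗ₜ[A] c) := by
    simp only [Algebra.TensorProduct.tmul_mul_tmul, mul_one]
    rw [mul_comm b0 c, hcb, Algebra.algebraMap_eq_smul_one, TensorProduct.smul_tmul]
  rw [e1, hm]
  ring

theorem capRel_one_iff (ξ : (T2 A B)ˣ) : CapRel A B ξ 1 ↔ ∃ u, d1 A B u = ξ := by
  constructor
  · rintro ⟨I, b, hb, hI, hξ, hc⟩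
    obtain ⟨I, hI0⟩ := I
    rw [ClassGroup.mk0_eq_one_iff] at hc
    obtain ⟨a, rfl⟩ := hc
    have hI' : Ideal.map (algebraMap A B) (Ideal.span {a}) = Ideal.span {b} := hI
    rw [Ideal.map_span, Set.image_singleton, Ideal.span_singleton_eq_span_singleton] at hI'
    obtain ⟨u, rfl⟩ := hI'
    have ha : algebraMap A B a ≠ 0 := left_ne_zero_of_mul hb
    refine ⟨u, (cap_d1_eq_iff _ _).2 ?_⟩
    apply cap_regL _ (cap_canc ha)
    have e : (algebraMap A B a ⊗ₜ[A] (1 : B)) = ((1 : B) ⊗ₜ[A] algebraMap A B a) := by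
      rw [Algebra.algebraMap_eq_smul_one, TensorProduct.smul_tmul]
    rw [mul_left_comm]
    nth_rewrite 2 [e]
    simpa using hξ
  · rintro ⟨u, hu⟩
    refine ⟨1, u, u.ne_zero, ?_, (cap_d1_eq_iff _ _).1 hu, map_one _⟩
    rw [Submonoid.coe_one, Ideal.one_eq_top, Ideal.map_top, eq_comm, Ideal.span_singleton_eq_top]
    exact u.isUnit

theorem capRel_exists (I : (Ideal A)⁰) (h : ((I : Ideal A).map (algebraMap A B)).IsPrincipal) :
    ∃ ξ : (T2 A B)ˣ, d2 A B ξ = 1 ∧ CapRel A B ξ (ClassGroup.mk0 I) := by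
  obtain ⟨b, hb⟩ := h
  have hb : (I : Ideal A).map (algebraMap A B) = Ideal.span {b} := hb
  have hb0 : b ≠ 0 := by
    rintro rfl
    rw [Ideal.span_singleton_eq_bot.2 rfl,
      Ideal.map_eq_bot_iff_of_injective (FaithfulSMul.algebraMap_injective A B)] at hb
    exact nonZeroDivisors.ne_zero I.2 hb
  have eL : (I : Ideal A).map (algebraMap A (T2 A B)) = Ideal.span {b ⊗ₜ[A] (1 : B)} := by
    have : algebraMap A (T2 A B) =
      (Algebra.TensorProduct.includeLeft : B →ₐ[A] T2 A B).toRingHom.comp (algebraMap A B) :=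
      RingHom.ext fun a =>
        ((Algebra.TensorProduct.includeLeft : B →ₐ[A] T2 A B).commutes a).symm
    rw [this, ← Ideal.map_map, hb, Ideal.map_span, Set.image_singleton]
    rfl
  have eR : (I : Ideal A).map (algebraMap A (T2 A B)) = Ideal.span {(1 : B) ⊗ₜ[A] b} := by
    have : algebraMap A (T2 A B) =
      (Algebra.TensorProduct.includeRight : B →ₐ[A] T2 A B).toRingHom.comp (algebraMap A B) :=
      RingHom.ext fun a =>
        ((Algebra.TensorProduct.includeRight : B →ₐ[A] T2 A B).commutes a).symm
    rw [this, ← Ideal.map_map, hb, Ideal.map_span, Set.image_singleton]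
    rfl
  have hLR := eL.symm.trans eR
  obtain ⟨x, hx⟩ := Ideal.mem_span_singleton'.1 (hLR ▸ Ideal.mem_span_singleton_self _ :
    b ⊗ₜ[A] (1 : B) ∈ Ideal.span {(1 : B) ⊗ₜ[A] b})
  obtain ⟨y, hy⟩ := Ideal.mem_span_singleton'.1 (hLR ▸ Ideal.mem_span_singleton_self _ :
    (1 : B) ⊗ₜ[A] b ∈ Ideal.span {b ⊗ₜ[A] (1 : B)})
  have hxy : x * y = 1 := by
    apply cap_regL b (cap_canc hb0)
    rw [mul_one]
    calc (b ⊗ₜ[A] (1 : B)) * (x * y) = x * (y * (b ⊗ₜ[A] (1 : B))) := by ring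
      _ = _ := by rw [hy, hx]
  let ξ : (T2 A B)ˣ := ⟨x, y, hxy, by rw [mul_comm, hxy]⟩
  refine ⟨ξ, ?_, I, b, hb0, hb, hx.symm, rfl⟩
  rw [cap_d2_eq_one_iff]
  apply cap_regR ((1 : B) ⊗ₜ[A] b) (fun x y h => cap_regR b (cap_canc hb0) x y h)
  have h12 := congrArg (q12 A B) hx
  have h13 := congrArg (q13 A B) hx
  have h23 := congrArg (q23 A B) hx
  rw [map_mul] at h12 h13 h23
  simp only [q12, q13, q23, Algebra.TensorProduct.map_tmul, Algebra.TensorProduct.includeLeft_apply,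
    Algebra.TensorProduct.includeRight_apply, AlgHom.id_apply, map_one] at h12 h13 h23
  show _ * (Algebra.TensorProduct.map (AlgHom.id A B) Algebra.TensorProduct.includeLeft x *
    Algebra.TensorProduct.includeRight x) = _ *
    Algebra.TensorProduct.map (AlgHom.id A B) Algebra.TensorProduct.includeRight x
  have key : ∀ {R : Type _} [CommRing R] (t p q r s v : R), q * t = s → p * s = v → r * t = v →
      t * (p * q) = t * r := by
    intro R _ t p q r s v h1 h2 h3
    rw [mul_comm t r, h3, ← h2, ← h1]
    ring
  exact key (R := T3 A B) _ _ _ _ _ _ h23 h12 h13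

theorem capRel_pow [IsDedekindDomain B] (n : ℕ) (hn : Module.finrank A B = n) (ξ : (T2 A B)ˣ)
    (c : ClassGroup A) (h : CapRel A B ξ c) : c ^ n = 1 := by
  obtain ⟨I, b, hb, hI, hξ, rfl⟩ := h
  obtain ⟨I, hI0⟩ := I
  rw [← map_pow, SubmonoidClass.mk_pow, ClassGroup.mk0_eq_one_iff]
  have := Ideal.relNorm_algebraMap B I
  rw [show Ideal.map (algebraMap A B) I = _ from hI, Ideal.relNorm_singleton, hn] at this
  exact ⟨_, this.symm⟩

end CapRing


section CapGen

set_option maxHeartbeats 2000000 in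
theorem capGen {A B : Type*} [CommRing A] [CommRing B] [Algebra A B] [IsDedekindDomain A]
    [IsDedekindDomain B] [Module.Finite A B] [Module.Projective A B] [FaithfulSMul A B]
    (n : ℕ) (hrank : Module.finrank A B = n) :
    let UF := (Units.map (algebraMap A B).toMonoidHom).range
    let cs : Set (ClassGroup A) := {c | ∃ I : (Ideal A)⁰, ClassGroup.mk0 I = c ∧
      (Ideal.map (algebraMap A B) (I : Ideal A)).IsPrincipal}
    let UKn := (powMonoidHom n : Bˣ →* Bˣ).range
    let μ1 := rootsOfUnity n B
    let μ2 := rootsOfUnity n (T2 A B)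
    let μ3 := rootsOfUnity n (T3 A B)
    let Ψ := ((powMonoidHom n : (T2 A B)ˣ →* (T2 A B)ˣ).range).comap (d1 A B)
    let G1 := ↥(UF ⊓ UKn) ⧸
      ((Subgroup.map (powMonoidHom n) UF).subgroupOf (UF ⊓ UKn))
    let G2 := ↥(μ2 ⊓ (d2 A B).ker) ⧸
      ((Subgroup.map (d1 A B) μ1).subgroupOf (μ2 ⊓ (d2 A B).ker))
    let G4 := ↥Ψ ⧸ ((UF ⊔ UKn).subgroupOf Ψ)
    let G5 := ↥(μ3 ⊓ (d3 A B).ker) ⧸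
      ((Subgroup.map (d2 A B) μ2).subgroupOf (μ3 ⊓ (d3 A B).ker))
    ∃ (Cap : Subgroup (ClassGroup A)) (φ₁ : G1 →* G2) (φ₂ : G2 →* ↥Cap)
      (φ₃ : ↥Cap →* G4) (φ₄ : G4 →* G5),
      (Cap : Set (ClassGroup A)) = cs ∧
      Function.Injective φ₁ ∧
      φ₁.range = φ₂.ker ∧ φ₂.range = φ₃.ker ∧ φ₃.range = φ₄.ker ∧
      (∀ x : G1, x ^ n = 1) ∧ (∀ x : G2, x ^ n = 1) ∧ (∀ x : ↥Cap, x ^ n = 1) ∧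
      (∀ x : G4, x ^ n = 1) ∧ (∀ x : G5, x ^ n = 1) ∧
      (∀ (u : Bˣ) (x : ↥(UF ⊓ UKn)), (x : Bˣ) = u ^ n →
        ∀ z : ↥(μ2 ⊓ (d2 A B).ker), (z : (T2 A B)ˣ) = d1 A B u →
          φ₁ (QuotientGroup.mk x) = QuotientGroup.mk z) := by
  obtain ⟨δ, hδ⟩ := relHom (G := (d2 A B).ker) (H := ClassGroup A)
    (fun ξ c => CapRel A B ξ c)
    (fun g h g' h' H H' => capRel_mul _ _ _ _ H H')
    (fun ξ => capRel_total ξ.1 ξ.2) (fun c h => capRel_one c h)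
  refine @absSeq Bˣ (T2 A B)ˣ (T3 A B)ˣ (T4 A B)ˣ (ClassGroup A) inferInstance inferInstance
    inferInstance inferInstance inferInstance n (d1 A B) (d2 A B) (d3 A B)
    cap_d2_d1 cap_d3_d2 (Units.map (algebraMap A B).toMonoidHom).range (fun x => cap_d1_ker x)
    (rootsOfUnity n B) (fun x => mem_rootsOfUnity n x)
    (rootsOfUnity n (T2 A B)) (fun x => mem_rootsOfUnity n x)
    (rootsOfUnity n (T3 A B)) (fun x => mem_rootsOfUnity n x)
    δ (fun x => (hδ x 1).symm.trans (capRel_one_iff _))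
    (fun x => capRel_pow n hrank x.1 _ ((hδ _ _).2 rfl))
    {c | ∃ I : (Ideal A)⁰, ClassGroup.mk0 I = c ∧
      (Ideal.map (algebraMap A B) (I : Ideal A)).IsPrincipal} ?_
  intro c
  constructor
  · rintro ⟨I, rfl, hI⟩
    obtain ⟨ξ, h1, h2⟩ := capRel_exists I hI
    exact ⟨⟨ξ, h1⟩, (hδ _ _).1 h2⟩
  · rintro ⟨x, hx⟩
    obtain ⟨I, b, -, hI, -, hc⟩ := (hδ _ _).2 hx
    exact ⟨I, hc, ⟨⟨b, hI⟩⟩⟩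

end CapGen



section CapArith

theorem cap_pi {R : Type*} [CommRing R] [IsDedekindDomain R] [Finite (ClassGroup R)]
    (v : HeightOneSpectrum R) : ∃ π ∈ v.asIdeal, π ≠ 0 ∧
      ∀ v' : HeightOneSpectrum R, π ∈ v'.asIdeal → v' = v := by
  have hv0 : v.asIdeal ∈ (Ideal R)⁰ := mem_nonZeroDivisors_iff_ne_zero.2 v.ne_bot
  have hh : 0 < Nat.card (ClassGroup R) := Nat.card_pos
  have h1 : ClassGroup.mk0 ⟨v.asIdeal, hv0⟩ ^ Nat.card (ClassGroup R) = 1 := pow_card_eq_one'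
  rw [← map_pow, SubmonoidClass.mk_pow, ClassGroup.mk0_eq_one_iff] at h1
  obtain ⟨π, hπ⟩ := h1
  have hπ : v.asIdeal ^ Nat.card (ClassGroup R) = Ideal.span {π} := hπ
  refine ⟨π, ?_, ?_, ?_⟩
  · exact Ideal.pow_le_self hh.ne' (hπ ▸ Ideal.mem_span_singleton_self π)
  · rintro rfl
    rw [Ideal.span_singleton_eq_bot.2 rfl] at hπ
    exact v.ne_bot ((pow_eq_zero_iff hh.ne').1 hπ)
  · intro v' h'
    have : v.asIdeal ^ Nat.card (ClassGroup R) ≤ v'.asIdeal := by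
      rw [hπ, Ideal.span_singleton_le_iff_mem]
      exact h'
    have := Ideal.IsPrime.le_of_pow_le this
    exact (HeightOneSpectrum.ext (v.isMaximal.eq_of_le v'.isPrime.ne_top this)).symm

variable {F K : Type*} [Field F] [NumberField F] [Field K] [NumberField K] [Algebra F K]
  (S : Set (HeightOneSpectrum (𝓞 F)))

theorem cap_fracA : IsFractionRing (OFS F S) F := by
  have inj : Function.Injective (algebraMap (OFS F S) F) := Subtype.val_injective
  refine IsFractionRing.of_field (OFS F S) F fun z => ?_
  obtain ⟨x, y, hy, rfl⟩ := IsFractionRing.div_surjective (A := 𝓞 F) z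
  exact ⟨algebraMap (𝓞 F) (OFS F S) x, algebraMap (𝓞 F) (OFS F S) y, rfl⟩

theorem cap_B_int (x : K) (hx : x ∈ (primesOver F K S).integer K) : IsIntegral (OFS F S) x := by
  let D : Ideal (integralClosure (OFS F S) K) :=
    { carrier := {d | IsIntegral (OFS F S) ((d : K) * x)}
      add_mem' := by
        intro a b ha hb
        simp only [Set.mem_ofPred_eq] at *
        rw [Subalgebra.coe_add, add_mul]
        exact ha.add hb
      zero_mem' := by simp [isIntegral_zero]
      smul_mem' := by
        intro c d hd
        simp only [Set.mem_ofPred_eq] at *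
        rw [smul_eq_mul, Subalgebra.coe_mul, mul_assoc]
        exact c.2.mul hd }
  by_contra hcon
  have hD : D ≠ ⊤ := by
    intro h
    have : (1 : integralClosure (OFS F S) K) ∈ D := by rw [h]; trivial
    apply hcon
    have h' : IsIntegral (OFS F S) (((1 : integralClosure (OFS F S) K) : K) * x) := this
    simpa using h'
  obtain ⟨P, hP, hDP⟩ := Ideal.exists_le_maximal D hD
  have hInt : ∀ y : 𝓞 K, IsIntegral (OFS F S) (algebraMap (𝓞 K) K y) := fun y =>
    IsIntegral.tower_top (R := ℤ) (RingOfIntegers.isIntegral_coe y)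
  let ι : 𝓞 K →+* integralClosure (OFS F S) K :=
    (algebraMap (𝓞 K) K).codRestrict (integralClosure (OFS F S) K).toSubring hInt
  have key : ∀ s r : 𝓞 K, s ∉ P.comap ι → x * algebraMap (𝓞 K) K s = algebraMap (𝓞 K) K r →
      False := by
    intro s r hs h
    apply hs
    apply hDP
    show IsIntegral (OFS F S) (algebraMap (𝓞 K) K s * x)
    rw [mul_comm, h]
    exact hInt r
  have hprime : (P.comap ι).IsPrime := Ideal.comap_isPrime ι P
  by_cases hw : P.comap ι = ⊥
  · obtain ⟨r, s, hs, hrs⟩ := IsFractionRing.div_surjective (A := 𝓞 K) x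
    have hs0 : s ≠ 0 := nonZeroDivisors.ne_zero hs
    refine key s r ?_ ?_
    · rw [hw]
      exact hs0
    · rw [← hrs, div_mul_cancel₀]
      simpa using hs0
  · let w : HeightOneSpectrum (𝓞 K) := ⟨P.comap ι, hprime, hw⟩
    by_cases hwS : w ∈ primesOver F K S
    · obtain ⟨v, hv, hcomap⟩ := hwS
      obtain ⟨π, hπv, hπ0, hπ⟩ := cap_pi v
      have hπ' : algebraMap (𝓞 F) (𝓞 K) π ∈ P.comap ι := by
        rw [← hcomap] at hπv
        exact hπv
      have hA : (algebraMap (𝓞 F) F π)⁻¹ ∈ S.integer F := by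
        intro v' hv'
        have : π ∉ v'.asIdeal := fun h => hv' (hπ v' h ▸ hv)
        rw [map_inv₀, HeightOneSpectrum.valuation_of_algebraMap,
          HeightOneSpectrum.intValuation_eq_one_iff.2 this, inv_one]
      apply hP.ne_top
      rw [Ideal.eq_top_iff_one]
      have := P.mul_mem_left (algebraMap (OFS F S) _ ⟨_, hA⟩) hπ'
      convert this using 1
      apply Subtype.ext
      show (1 : K) = algebraMap F K (algebraMap (𝓞 F) F π)⁻¹ *
        algebraMap (𝓞 K) K (algebraMap (𝓞 F) (𝓞 K) π)
      rw [← IsScalarTower.algebraMap_apply, IsScalarTower.algebraMap_apply (𝓞 F) F K, map_inv₀,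
        inv_mul_cancel₀]
      simpa using hπ0
    · obtain ⟨r, s, h⟩ := w.exists_primeCompl_mul_eq_of_integer x (hx w hwS)
      exact key s r s.2 h

theorem cap_int_B (x : K) (hx : IsIntegral (OFS F S) x) : x ∈ (primesOver F K S).integer K := by
  intro w hw
  let V := (w.valuation K).valuationSubring
  let v : HeightOneSpectrum (𝓞 F) :=
    ⟨w.asIdeal.under (𝓞 F), inferInstance, Ideal.IsIntegral.comap_ne_bot _ w.ne_bot⟩
  have hv : v ∉ S := fun h => hw ⟨v, h, rfl⟩
  have : w.asIdeal.LiesOver v.asIdeal := ⟨rfl⟩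
  have hAV : ∀ a : OFS F S, algebraMap F K a ∈ V := by
    intro a
    show w.valuation K (algebraMap F K a) ≤ 1
    rw [← HeightOneSpectrum.valuation_liesOver K v w]
    exact pow_le_one' (a.2 v hv) _
  let f : OFS F S →+* V := ((algebraMap F K).comp (algebraMap (OFS F S) F)).codRestrict V.toSubring hAV
  let := f.toAlgebra
  have : IsScalarTower (OFS F S) V K := IsScalarTower.of_algebraMap_eq fun a => rfl
  have h2 : IsIntegral V x := hx.tower_top
  obtain ⟨y, rfl⟩ := IsIntegrallyClosed.isIntegral_iff.1 h2
  exact y.2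

variable [Algebra (OFS F S) (OKS F K S)]

theorem cap_tower (hAB : ∀ a : OFS F S, ((algebraMap (OFS F S) (OKS F K S) a : OKS F K S) : K) =
      algebraMap F K (a : F)) : IsScalarTower (OFS F S) (OKS F K S) K :=
  IsScalarTower.of_algebraMap_eq fun a => (hAB a).symm

theorem cap_intcl (hAB : ∀ a : OFS F S, ((algebraMap (OFS F S) (OKS F K S) a : OKS F K S) : K) =
      algebraMap F K (a : F)) : IsIntegralClosure (OKS F K S) (OFS F S) K where
  algebraMap_injective := Subtype.val_injective
  isIntegral_iff := by
    intro x
    constructor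
    · intro h
      exact ⟨⟨x, cap_int_B S x h⟩, rfl⟩
    · rintro ⟨y, rfl⟩
      exact cap_B_int S _ y.2

theorem cap_facts [FiniteDimensional F K] (n : ℕ) (hdeg : Module.finrank F K = n)
    [IsDedekindDomain (OFS F S)]
    (hAB : ∀ a : OFS F S, ((algebraMap (OFS F S) (OKS F K S) a : OKS F K S) : K) =
      algebraMap F K (a : F)) :
    IsDedekindDomain (OKS F K S) ∧ Module.Finite (OFS F S) (OKS F K S) ∧
    Module.Projective (OFS F S) (OKS F K S) ∧ FaithfulSMul (OFS F S) (OKS F K S) ∧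
    Module.finrank (OFS F S) (OKS F K S) = n := by
  have i1 := cap_fracA S
  have i2 := cap_tower S hAB
  have i3 := cap_intcl S hAB
  have i4 : IsDedekindDomain (OKS F K S) :=
    IsIntegralClosure.isDedekindDomain (OFS F S) F K (OKS F K S)
  have i5 : Module.Finite (OFS F S) (OKS F K S) :=
    IsIntegralClosure.finite (OFS F S) F K (OKS F K S)
  have i6 : IsFractionRing (OKS F K S) K :=
    IsIntegralClosure.isFractionRing_of_finite_extension (OFS F S) F K (OKS F K S)
  have i7 : Module.IsTorsionFree (OFS F S) (OKS F K S) :=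
    IsIntegralClosure.isTorsionFree (OFS F S) K
  have i8 : FaithfulSMul (OFS F S) (OKS F K S) := inferInstance
  have i9 : Module.Flat (OFS F S) (OKS F K S) := inferInstance
  have i10 : Module.FinitePresentation (OFS F S) (OKS F K S) :=
    Module.finitePresentation_of_finite _ _
  refine ⟨i4, i5, Module.Flat.projective_of_finitePresentation, i8, ?_⟩
  rw [← hdeg]
  exact (IsFractionRing.finrank_eq (OFS F S) F (OKS F K S) K).symm

end CapArith

set_option maxHeartbeats 2000000 in
set_option synthInstance.maxHeartbeats 2000000 in
/-- For a degree `n ≥ 2` extension `K/F` of number fields and a finite set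
`S` of primes of `F`, with `A = O_{F,S}` and `B = O_{K,S}`, there are a subgroup `Cap` of the
class group of `A`, whose underlying set is the set of capitulating classes, and an exact
sequence of `n`-torsion abelian groups
`1 → (U_F ∩ U_Kⁿ)/U_Fⁿ → Ȟ¹(B/A, μ_n) → Cap → Ψ/(U_F·U_Kⁿ) → Ȟ²(B/A, μ_n)`,
in which `φ₁` sends the class of `a = uⁿ` to the class of `(u ⊗ 1)·(1 ⊗ u)⁻¹`. -/
theorem stmt14 [FiniteDimensional F K] (n : ℕ) (hdeg : Module.finrank F K = n) (hn : 2 ≤ n)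
    (hS : S.Finite)
    [IsDedekindDomain (OFS F S)] [Algebra (OFS F S) (OKS F K S)]
    (hAB : ∀ a : OFS F S, ((algebraMap (OFS F S) (OKS F K S) a : OKS F K S) : K) =
      algebraMap F K (a : F)) :
    -- abbreviations
    let A := OFS F S
    let B := OKS F K S
    -- `U_Kⁿ` and the `n`-torsion (= `μ_n`) subgroups of the units of tensor powers of `B`
    let UKn := (powMonoidHom n : Bˣ →* Bˣ).range
    let μ1 := rootsOfUnity n B
    let μ2 := rootsOfUnity n (T2 A B)
    let μ3 := rootsOfUnity n (T3 A B)
    -- `Ψ = {u ∈ U_K : (u⊗1)(1⊗u)⁻¹ ∈ ((B ⊗ B)ˣ)ⁿ}`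
    let Ψ := ((powMonoidHom n : (T2 A B)ˣ →* (T2 A B)ˣ).range).comap (d1 A B)
    -- the five groups of the sequence
    let G1 := ↥(UF F K S ⊓ UKn) ⧸
      ((Subgroup.map (powMonoidHom n) (UF F K S)).subgroupOf (UF F K S ⊓ UKn))
    let G2 := ↥(μ2 ⊓ (d2 A B).ker) ⧸
      ((Subgroup.map (d1 A B) μ1).subgroupOf (μ2 ⊓ (d2 A B).ker))
    let G4 := ↥Ψ ⧸ ((UF F K S ⊔ UKn).subgroupOf Ψ)
    let G5 := ↥(μ3 ⊓ (d3 A B).ker) ⧸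
      ((Subgroup.map (d2 A B) μ2).subgroupOf (μ3 ⊓ (d3 A B).ker))
    ∃ (Cap : Subgroup (ClassGroup A)) (φ₁ : G1 →* G2) (φ₂ : G2 →* ↥Cap)
      (φ₃ : ↥Cap →* G4) (φ₄ : G4 →* G5),
      -- the subgroup `Cap` consists exactly of the capitulating classes
      (Cap : Set (ClassGroup A)) = capSet F K S ∧
      -- exactness of 1 → G1 → G2 → Cap → G4 → G5
      Function.Injective φ₁ ∧
      φ₁.range = φ₂.ker ∧ φ₂.range = φ₃.ker ∧ φ₃.range = φ₄.ker ∧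
      -- every group in the sequence is annihilated by n
      (∀ x : G1, x ^ n = 1) ∧ (∀ x : G2, x ^ n = 1) ∧ (∀ x : ↥Cap, x ^ n = 1) ∧
      (∀ x : G4, x ^ n = 1) ∧ (∀ x : G5, x ^ n = 1) ∧
      -- φ₁ sends the class of `a = uⁿ ∈ U_F ∩ U_Kⁿ` to the class of `(u⊗1)·(1⊗u)⁻¹`
      (∀ (u : Bˣ) (x : ↥(UF F K S ⊓ UKn)), (x : Bˣ) = u ^ n →
        ∀ z : ↥(μ2 ⊓ (d2 A B).ker), (z : (T2 A B)ˣ) = d1 A B u →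
          φ₁ (QuotientGroup.mk x) = QuotientGroup.mk z) := by
  obtain ⟨i1, i2, i3, i4, hrank⟩ := cap_facts S n hdeg hAB
  exact capGen (A := OFS F S) (B := OKS F K S) n hrank
end
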